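/- arXiv:1404.2853 — 4 statements merged into one kernel-verified Lean document; each statement's English description precedes it below -/
import Mathlib

section
/- Let U be an open neighborhood of 0 in ℂ² and let Φ : ℂ² → ℂ³ be complex-analytic on U with Φ(0) = 0. Assume that for every z ∈ U with z ≠ 0 the complex derivative dΦ_z : ℂ² → ℂ³ is injective (i.e. has rank 2). Then 0 is an isolated point of the fiber Φ⁻¹(0): there exists r > 0 such that Φ(z) ≠ 0 for every z with 0 < ‖z‖ < r. -/
open Set Filter Topology Metric

/-- Finiteness of the zero set. -/
lemma aux_finite_zeros {ε : ℝ} (hε : 0 < ε) {F : ℂ → ℂ}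
    (hF : AnalyticOnNhd ℂ F (closedBall 0 ε)) (hs : ∀ w ∈ sphere (0 : ℂ) ε, F w ≠ 0) :
    {w ∈ closedBall (0 : ℂ) ε | F w = 0}.Finite := by
  by_contra hinf
  obtain ⟨a, ha, hacc⟩ := Set.Infinite.exists_accPt_of_subset_isCompact hinf
    (isCompact_closedBall (0 : ℂ) ε) (sep_subset _ _)
  rw [accPt_iff_frequently_nhdsNE] at hacc
  have h := hF.eqOn_zero_of_preconnected_of_frequently_eq_zero
    (convex_closedBall (0 : ℂ) ε).isPreconnected ha (hacc.mono fun z hz => hz.2)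
  have hmem : (ε : ℂ) ∈ sphere (0 : ℂ) ε := by simp [abs_of_pos hε]
  exact hs _ hmem (h (sphere_subset_closedBall hmem))

/-- Factoring out all zeros in the disc. -/
lemma aux_factor {ε : ℝ} (hε : 0 < ε) (n : ℕ) : ∀ {F : ℂ → ℂ}
    (_ : AnalyticOnNhd ℂ F (closedBall 0 ε)) (_ : ∀ w ∈ sphere (0 : ℂ) ε, F w ≠ 0)
    (_ : {w ∈ closedBall (0 : ℂ) ε | F w = 0}.ncard = n),
    ∃ (s : Multiset ℂ) (u : ℂ → ℂ), (∀ a ∈ s, a ∈ ball (0 : ℂ) ε) ∧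
      AnalyticOnNhd ℂ u (closedBall 0 ε) ∧ (∀ w ∈ closedBall (0 : ℂ) ε, u w ≠ 0) ∧
      ∀ w, F w = (s.map fun a => w - a).prod * u w := by
  induction n with
  | zero =>
    intro F hF hs hn
    refine ⟨0, F, by simp, hF, fun w hw h0 => ?_, by simp⟩
    rw [Set.ncard_eq_zero (aux_finite_zeros hε hF hs)] at hn
    exact (hn ▸ (show w ∈ {w ∈ closedBall (0 : ℂ) ε | F w = 0} from ⟨hw, h0⟩) : w ∈ (∅ : Set ℂ))
  | succ n ih =>
    intro F hF hs hn
    have hfin := aux_finite_zeros hε hF hs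
    obtain ⟨a, ha⟩ : {w ∈ closedBall (0 : ℂ) ε | F w = 0}.Nonempty := by
      rw [← Set.ncard_pos hfin]; omega
    have haball : a ∈ ball (0 : ℂ) ε := by
      have h1 : a ∉ sphere (0 : ℂ) ε := fun h => hs a h ha.2
      have h2 := ha.1
      simp only [mem_closedBall, mem_sphere, mem_ball] at *
      exact lt_of_le_of_ne h2 h1
    have hne : ¬ ∀ᶠ z in 𝓝 a, F z = 0 := by
      intro h
      have h := hF.eqOn_zero_of_preconnected_of_eventuallyEq_zero
        (convex_closedBall (0 : ℂ) ε).isPreconnected ha.1 h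
      have hmem : (ε : ℂ) ∈ sphere (0 : ℂ) ε := by simp [abs_of_pos hε]
      exact hs _ hmem (h (sphere_subset_closedBall hmem))
    obtain ⟨m, g, hg, hga, hFg⟩ := (hF a ha.1).exists_eventuallyEq_pow_smul_nonzero_iff.2 hne
    classical
    let F1 : ℂ → ℂ := Function.update (fun w => F w / (w - a) ^ m) a (g a)
    have hm : m ≠ 0 := by
      rintro rfl
      have := hFg.self_of_nhds
      simp [ha.2] at this
      exact hga this.symm
    have hF1a : F1 a = g a := by simp [F1]
    have hF1 : ∀ w, w ≠ a → F1 w = F w / (w - a) ^ m := fun w hw => by simp [F1, hw]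
    have hFF1 : ∀ w, F w = (w - a) ^ m * F1 w := by
      intro w
      by_cases hw : w = a
      · subst hw; simp [ha.2, hm]
      · rw [hF1 w hw]
        have : (w - a) ^ m ≠ 0 := pow_ne_zero _ (sub_ne_zero.2 hw)
        field_simp
    have han : AnalyticOnNhd ℂ F1 (closedBall 0 ε) := by
      intro w hw
      by_cases hwa : w = a
      · subst hwa
        refine hg.congr ?_
        filter_upwards [hFg] with z hz
        by_cases hzw : z = w
        · rw [hzw, hF1a]
        · rw [hF1 z hzw, hz]
          have : (z - w) ^ m ≠ 0 := pow_ne_zero _ (sub_ne_zero.2 hzw)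
          simp only [smul_eq_mul]
          field_simp
      · have h1 : AnalyticAt ℂ (fun w => F w / (w - a) ^ m) w :=
          (hF w hw).div ((analyticAt_id.sub analyticAt_const).pow m)
            (pow_ne_zero _ (sub_ne_zero.2 hwa))
        refine h1.congr ?_
        filter_upwards [isOpen_ne.mem_nhds hwa] with z hz
        rw [hF1 z hz]
    have hs1 : ∀ w ∈ sphere (0 : ℂ) ε, F1 w ≠ 0 := fun w hw h => hs w hw (by rw [hFF1, h, mul_zero])
    have hset : {w ∈ closedBall (0 : ℂ) ε | F1 w = 0} =
        {w ∈ closedBall (0 : ℂ) ε | F w = 0} \ {a} := by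
      ext w
      by_cases hwa : w = a
      · subst hwa; simp [hF1a, hga]
      · simp [hFF1 w, hwa, sub_ne_zero.2 hwa]
    obtain ⟨s, u, h1, h2, h3, h4⟩ := ih han hs1 (by
      rw [hset, Set.ncard_sdiff_singleton_of_mem ha, hn]; rfl)
    refine ⟨Multiset.replicate m a + s, u, ?_, h2, h3, fun w => ?_⟩
    · intro b hb
      rcases Multiset.mem_add.1 hb with hb | hb
      · rw [Multiset.eq_of_mem_replicate hb]; exact haball
      · exact h1 b hb
    · rw [hFF1 w, h4 w]; simp [mul_assoc]

/-- Weighted argument principle, for a factored function. -/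
lemma aux_arg {ε : ℝ} (hε : 0 < ε) {G u : ℂ → ℂ}
    (hG : AnalyticOnNhd ℂ G (closedBall 0 ε)) (hu : AnalyticOnNhd ℂ u (closedBall 0 ε))
    (hu0 : ∀ w ∈ closedBall (0 : ℂ) ε, u w ≠ 0) (s : Multiset ℂ) :
    (∀ a ∈ s, a ∈ ball (0 : ℂ) ε) →
    CircleIntegrable (fun w => G w * logDeriv (fun w => (s.map fun a => w - a).prod * u w) w) 0 ε ∧
    (∮ w in C(0, ε), G w * logDeriv (fun w => (s.map fun a => w - a).prod * u w) w) =
      2 * Real.pi * Complex.I * (s.map G).sum := by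
  induction s using Multiset.induction_on with
  | empty =>
    intro _
    have hd : DifferentiableOn ℂ (fun w => G w * logDeriv u w) (closedBall 0 ε) := fun w hw =>
      ((hG w hw).mul ((hu w hw).deriv.div (hu w hw) (hu0 w hw))).differentiableAt.differentiableWithinAt
    simp only [Multiset.map_zero, Multiset.prod_zero, one_mul, Multiset.sum_zero, mul_zero]
    refine ⟨(hd.continuousOn.mono sphere_subset_closedBall).circleIntegrable hε.le, ?_⟩
    exact DiffContOnCl.circleIntegral_eq_zero hε.le
      (hd.mono closure_ball_subset_closedBall).diffContOnCl
  | cons b s ih =>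
    intro hs
    obtain ⟨ih1, ih2⟩ := ih fun a ha => hs a (Multiset.mem_cons_of_mem ha)
    have hb := hs b (Multiset.mem_cons_self b s)
    have hGd : DifferentiableOn ℂ G (closedBall 0 ε) := hG.differentiableOn
    have hne : ∀ w ∈ sphere (0 : ℂ) ε, ∀ a ∈ b ::ₘ s, w - a ≠ 0 := by
      intro w hw a ha h
      have := hs a ha
      rw [sub_eq_zero.1 h] at hw
      simp only [mem_sphere, mem_ball] at *
      linarith
    have hci : CircleIntegrable (fun w => (w - b)⁻¹ • G w) 0 ε := by
      refine ContinuousOn.circleIntegrable hε.le ?_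
      refine ContinuousOn.smul (ContinuousOn.inv₀ (by fun_prop) fun w hw =>
        hne w hw b (Multiset.mem_cons_self b s)) (hGd.continuousOn.mono sphere_subset_closedBall)
    have hdP : Differentiable ℂ (fun w : ℂ => (s.map fun a => w - a).prod) := by
      clear * -
      induction s using Multiset.induction_on with
      | empty => simp
      | cons b s ih => simp only [Multiset.map_cons, Multiset.prod_cons]; fun_prop
    have heq : EqOn (fun w => G w * logDeriv (fun w => ((b ::ₘ s).map fun a => w - a).prod * u w) w)
        (fun w => (w - b)⁻¹ • G w +
          G w * logDeriv (fun w => (s.map fun a => w - a).prod * u w) w) (sphere 0 ε) := by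
      intro w hw
      have h1 : (fun w => ((b ::ₘ s).map fun a => w - a).prod * u w) =
        fun w => (w - b) * ((s.map fun a => w - a).prod * u w) := by
        ext w; simp [mul_assoc]
      have hwc := sphere_subset_closedBall hw
      simp only
      rw [h1, logDeriv_mul (f := fun w => w - b)
        (g := fun w => (s.map fun a => w - a).prod * u w) w
        (hne w hw b (Multiset.mem_cons_self b s))
        (mul_ne_zero ?_ (hu0 w hwc)) (by fun_prop)
        ((hdP w).mul (hu w hwc).differentiableAt)]
      · have : logDeriv (fun w => w - b) w = (w - b)⁻¹ := by simp [logDeriv_apply]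
        rw [this, smul_eq_mul]; ring
      · rw [Ne, Multiset.prod_eq_zero_iff]
        intro h
        obtain ⟨a, ha, h⟩ := Multiset.mem_map.1 h
        exact hne w hw a (Multiset.mem_cons_of_mem ha) h
    constructor
    · refine (circleIntegrable_congr ?_).2 (hci.add ih1)
      rw [abs_of_pos hε]
      exact heq
    · rw [circleIntegral.integral_congr hε.le heq, circleIntegral.integral_add hci ih1, ih2,
        hGd.circleIntegral_sub_inv_smul hb]
      simp; ring

/-- Circle integrals depend holomorphically on parameters. -/
lemma aux_param {δ ε : ℝ} (hε : 0 < ε) {H : ℂ × ℂ → ℂ}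
    (hH : ∀ x ∈ ball (0 : ℂ) δ, ∀ w ∈ sphere (0 : ℂ) ε, AnalyticAt ℂ H (x, w)) :
    DifferentiableOn ℂ (fun x => ∮ w in C(0, ε), H (x, w)) (ball 0 δ) := by
  intro x₀ hx₀
  obtain ⟨ρ, hρ, hsub⟩ := nhds_basis_closedBall.mem_iff.1 (isOpen_ball.mem_nhds hx₀)
  have hcm : ∀ θ, circleMap 0 ε θ ∈ sphere (0 : ℂ) ε := fun θ => circleMap_mem_sphere 0 hε.le θ
  have hc1 : ContinuousOn (fun p : ℂ × ℝ => deriv (circleMap 0 ε) p.2 • H (p.1, circleMap 0 ε p.2))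
      (ball 0 δ ×ˢ univ) := by
    intro p hp
    have h1 : ContinuousAt H (p.1, circleMap 0 ε p.2) := (hH _ hp.1 _ (hcm _)).continuousAt
    have h2 : ContinuousAt (fun p : ℂ × ℝ => (p.1, circleMap 0 ε p.2)) p := by fun_prop
    have h3 : ContinuousAt (fun p : ℂ × ℝ => deriv (circleMap 0 ε) p.2) p := by
      simp only [deriv_circleMap]; fun_prop
    exact (h3.smul (ContinuousAt.comp (f := fun p : ℂ × ℝ => (p.1, circleMap 0 ε p.2)) h1 h2)).continuousWithinAt
  have hc2 : ContinuousOn (fun p : ℂ × ℝ => deriv (circleMap 0 ε) p.2 •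
      fderiv ℂ H (p.1, circleMap 0 ε p.2) (1, 0)) (ball 0 δ ×ˢ univ) := by
    intro p hp
    have h1 : ContinuousAt (fun z => fderiv ℂ H z (1, 0)) (p.1, circleMap 0 ε p.2) :=
      (hH _ hp.1 _ (hcm _)).fderiv.continuousAt.clm_apply continuousAt_const
    have h2 : ContinuousAt (fun p : ℂ × ℝ => (p.1, circleMap 0 ε p.2)) p := by fun_prop
    have h3 : ContinuousAt (fun p : ℂ × ℝ => deriv (circleMap 0 ε) p.2) p := by
      simp only [deriv_circleMap]; fun_prop
    exact (h3.smul (ContinuousAt.comp (f := fun p : ℂ × ℝ => (p.1, circleMap 0 ε p.2)) h1 h2)).continuousWithinAt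
  have hcs : ∀ {f : ℂ × ℝ → ℂ}, ContinuousOn f (ball 0 δ ×ˢ univ) → ∀ x ∈ ball (0 : ℂ) δ,
      Continuous fun θ => f (x, θ) := by
    intro f hf x hx
    refine continuousOn_univ.1 (hf.comp (by fun_prop) fun θ _ => ⟨hx, mem_univ _⟩)
  obtain ⟨C, hC⟩ := ((isCompact_closedBall x₀ ρ).prod (isCompact_uIcc (a := (0 : ℝ))
    (b := 2 * Real.pi))).exists_bound_of_continuousOn
    (hc2.mono (prod_mono hsub (subset_univ _)))
  have key := intervalIntegral.hasDerivAt_integral_of_dominated_loc_of_deriv_le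
    (μ := MeasureTheory.volume) (a := 0) (b := 2 * Real.pi) (bound := fun _ => C)
    (F := fun x θ => deriv (circleMap 0 ε) θ • H (x, circleMap 0 ε θ))
    (F' := fun x θ => deriv (circleMap 0 ε) θ • fderiv ℂ H (x, circleMap 0 ε θ) (1, 0))
    (closedBall_mem_nhds x₀ hρ)
    (by
      filter_upwards [isOpen_ball.mem_nhds hx₀] with x hx
      exact (hcs hc1 x hx).aestronglyMeasurable)
    ((hcs hc1 x₀ hx₀).intervalIntegrable _ _)
    ((hcs hc2 x₀ hx₀).aestronglyMeasurable)
    (Eventually.of_forall fun θ hθ x hx => hC (x, θ) ⟨hx, uIoc_subset_uIcc hθ⟩)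
    (by simp)
    (Eventually.of_forall fun θ hθ x hx => by
      have h1 := (hH x (hsub hx) _ (hcm θ)).differentiableAt.hasFDerivAt
      have h2 : HasDerivAt (fun x : ℂ => (x, circleMap 0 ε θ)) ((1 : ℂ), (0 : ℂ)) x :=
        (hasDerivAt_id x).prodMk (hasDerivAt_const x _)
      exact (h1.comp_hasDerivAt x h2).const_smul (deriv (circleMap 0 ε) θ))
  exact key.2.differentiableAt.differentiableWithinAt

/-- Newton's identities: elementary symmetric functions are holomorphic if power sums are. -/
lemma aux_newton {k : ℕ} {D : Set ℂ} (v : ℂ → Fin k → ℂ)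
    (hp : ∀ m : ℕ, DifferentiableOn ℂ (fun x => ∑ j, v x j ^ m) D) (m : ℕ) :
    DifferentiableOn ℂ
      (fun x => MvPolynomial.aeval (v x) (MvPolynomial.esymm (Fin k) ℂ m)) D := by
  induction m using Nat.strong_induction_on with
  | _ m ih =>
    rcases Nat.eq_zero_or_pos m with rfl | hm
    · simp
    have hm' : (m : ℂ) ≠ 0 := by exact_mod_cast hm.ne'
    have heq : (fun x => MvPolynomial.aeval (v x) (MvPolynomial.esymm (Fin k) ℂ m)) = fun x =>
        (m : ℂ)⁻¹ * ((-1) ^ (m + 1) * ∑ a ∈ Finset.HasAntidiagonal.antidiagonal m with a.1 < m, (-1) ^ a.1 *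
          MvPolynomial.aeval (v x) (MvPolynomial.esymm (Fin k) ℂ a.1) * ∑ j, v x j ^ a.2) := by
      funext x
      have h := congrArg (MvPolynomial.aeval (v x)) (MvPolynomial.mul_esymm_eq_sum (Fin k) ℂ m)
      simp only [map_mul, map_natCast, map_sum, map_pow, map_neg, map_one] at h
      have h2 : ∀ n, MvPolynomial.aeval (v x) (MvPolynomial.psum (Fin k) ℂ n) =
          ∑ j, v x j ^ n := by intro n; simp [MvPolynomial.psum]
      simp only [h2] at h
      rw [← h]
      field_simp
    rw [heq]
    refine DifferentiableOn.const_mul (DifferentiableOn.const_mul ?_ _) _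
    refine DifferentiableOn.fun_sum fun a ha => ?_
    exact ((ih a.1 (Finset.mem_filter.1 ha).2).const_mul _).mul (hp a.2)

lemma aux_newton_prod {k : ℕ} {D : Set ℂ} (v : ℂ → Fin k → ℂ)
    (hp : ∀ m : ℕ, DifferentiableOn ℂ (fun x => ∑ j, v x j ^ m) D) :
    DifferentiableOn ℂ (fun x => ∏ j, v x j) D := by
  have h := aux_newton v hp k
  refine h.congr fun x _ => ?_
  have : Finset.powersetCard k (Finset.univ : Finset (Fin k)) = {Finset.univ} := by
    have h := Finset.powersetCard_self (Finset.univ : Finset (Fin k))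
    rwa [Finset.card_fin] at h
  simp [MvPolynomial.esymm, this]

lemma aux_multiset {k : ℕ} (s : Multiset ℂ) (hs : s.card = k) :
    ∃ v : Fin k → ℂ, s = Finset.univ.val.map v := by
  induction s using Quotient.inductionOn with
  | _ l =>
    have : l.length = k := hs
    subst this
    exact ⟨l.get, by simp [Fin.univ_val_map]⟩

/-- Dichotomy: either the origin is an isolated common zero or there are uncountably many zeros. -/
lemma aux_core {f g h : ℂ × ℂ → ℂ} (hf : AnalyticAt ℂ f 0) (hg : AnalyticAt ℂ g 0)
    (hh : AnalyticAt ℂ h 0) (hf0 : ∀ᶠ w in 𝓝[≠] (0 : ℂ), f (0, w) ≠ 0)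
    {N : Set (ℂ × ℂ)} (hN : N ∈ 𝓝 (0 : ℂ × ℂ))
    (hZ : {z ∈ N | f z = 0 ∧ g z = 0 ∧ h z = 0}.Countable) :
    ∀ᶠ z in 𝓝[≠] (0 : ℂ × ℂ), ¬ (f z = 0 ∧ g z = 0 ∧ h z = 0) := by
  obtain ⟨r, hr, hrsub⟩ := Metric.eventually_nhds_iff_ball.1
    (hf.eventually_analyticAt.and (hg.eventually_analyticAt.and
      (hh.eventually_analyticAt.and (eventually_mem_set.2 hN))))
  rw [eventually_nhdsWithin_iff] at hf0
  obtain ⟨e, he, hesub⟩ := Metric.eventually_nhds_iff_ball.1 hf0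
  obtain ⟨ε, hε, hεm⟩ : ∃ ε : ℝ, 0 < ε ∧ ε < min r e := exists_between (lt_min hr he)
  have hεr : ε < r := hεm.trans_le (min_le_left _ _)
  have hεe : ε < e := hεm.trans_le (min_le_right _ _)
  have hf0' : ∀ w ∈ closedBall (0 : ℂ) ε, w ≠ 0 → f (0, w) ≠ 0 := fun w hw hw0 =>
    hesub w (closedBall_subset_ball hεe hw) hw0
  have hball : ∀ x ∈ ball (0 : ℂ) r, ∀ w ∈ closedBall (0 : ℂ) ε, (x, w) ∈ ball (0 : ℂ × ℂ) r := by
    intro x hx w hw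
    simp only [mem_ball, mem_closedBall, dist_zero_right, Prod.norm_mk, max_lt_iff] at *
    exact ⟨hx, hw.trans_lt hεr⟩
  have h1 : ∀ᶠ x in 𝓝 (0 : ℂ), ∀ w ∈ sphere (0 : ℂ) ε, f (x, w) ≠ 0 := by
    refine (isCompact_sphere (0 : ℂ) ε).eventually_forall_of_forall_eventually fun w hw => ?_
    have hwc := sphere_subset_closedBall hw
    have hw0 : w ≠ 0 := by rintro rfl; simp at hw; exact hε.ne hw
    exact (hrsub _ (hball 0 (mem_ball_self hr) w hwc)).1.continuousAt.eventually_ne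
      (hf0' w hwc hw0)
  obtain ⟨δ, hδ, hδsub⟩ := Metric.eventually_nhds_iff_ball.1
    (h1.and (eventually_mem_set.2 (ball_mem_nhds (0 : ℂ) hr)))
  have hxw : ∀ {G : ℂ × ℂ → ℂ}, (∀ z ∈ ball (0 : ℂ × ℂ) r, AnalyticAt ℂ G z) →
      ∀ x ∈ ball (0 : ℂ) δ, AnalyticOnNhd ℂ (fun w => G (x, w)) (closedBall 0 ε) := by
    intro G hG x hx w hw
    exact (hG _ (hball x (hδsub x hx).2 w hw)).fun_comp (f := fun w => (x, w)) (by fun_prop)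
  have hfa : ∀ z ∈ ball (0 : ℂ × ℂ) r, AnalyticAt ℂ f z := fun z hz => (hrsub z hz).1
  have hfac : ∀ x : ℂ, ∃ (s : Multiset ℂ) (u : ℂ → ℂ), x ∈ ball (0 : ℂ) δ →
      (∀ a ∈ s, a ∈ ball (0 : ℂ) ε) ∧
      AnalyticOnNhd ℂ u (closedBall 0 ε) ∧ (∀ w ∈ closedBall (0 : ℂ) ε, u w ≠ 0) ∧
      ∀ w, f (x, w) = (s.map fun a => w - a).prod * u w := by
    intro x
    by_cases hx : x ∈ ball (0 : ℂ) δ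
    · obtain ⟨s, u, H⟩ := aux_factor hε _ (hxw hfa x hx) (hδsub x hx).1 rfl
      exact ⟨s, u, fun _ => H⟩
    · exact ⟨0, 0, fun h => absurd h hx⟩
  choose s u hsu using hfac
  -- sums over the zeros are holomorphic
  have hsum : ∀ {G : ℂ × ℂ → ℂ}, (∀ z ∈ ball (0 : ℂ × ℂ) r, AnalyticAt ℂ G z) →
      DifferentiableOn ℂ (fun x => ((s x).map fun w => G (x, w)).sum) (ball 0 δ) := by
    intro G hG
    have hd := aux_param (δ := δ) hε (H := fun z => G z * (fderiv ℂ f z (0, 1) / f z)) (by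
      intro x hx w hw
      have hb := hball x (hδsub x hx).2 w (sphere_subset_closedBall hw)
      have h2 : AnalyticAt ℂ (fun z => fderiv ℂ f z (0, 1)) (x, w) :=
        ((ContinuousLinearMap.apply ℂ ℂ ((0, 1) : ℂ × ℂ)).analyticAt _).fun_comp (hfa _ hb).fderiv
      exact (hG _ hb).mul (h2.div (hfa _ hb) ((hδsub x hx).1 w hw)))
    refine (hd.const_mul (2 * Real.pi * Complex.I)⁻¹).congr fun x hx => ?_
    obtain ⟨hs1, hs2, hs3, hs4⟩ := hsu x hx
    have key := (aux_arg hε (hxw hG x hx) hs2 hs3 (s x) hs1).2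
    have hfx : (fun w => ((s x).map fun a => w - a).prod * u x w) = fun w => f (x, w) := by
      funext w; exact (hs4 w).symm
    rw [hfx] at key
    have hc : (∮ w in C(0, ε), G (x, w) * (fderiv ℂ f (x, w) (0, 1) / f (x, w))) =
        ∮ w in C(0, ε), G (x, w) * logDeriv (fun w => f (x, w)) w := by
      refine circleIntegral.integral_congr hε.le fun w hw => ?_
      have hb := hball x (hδsub x hx).2 w (sphere_subset_closedBall hw)
      have h2 : HasDerivAt (fun w : ℂ => (x, w)) ((0 : ℂ), (1 : ℂ)) w :=
        (hasDerivAt_const w x).prodMk (hasDerivAt_id w)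
      have h3 := ((hfa _ hb).differentiableAt.hasFDerivAt.comp_hasDerivAt w h2).deriv
      have h4 : deriv (fun w => f (x, w)) w = fderiv ℂ f (x, w) (0, 1) := h3
      simp only [logDeriv_apply, h4]
    simp only [hc, key]
    rw [inv_mul_cancel_left₀ Complex.two_pi_I_ne_zero]
  -- the number of zeros is locally constant
  have hcard : ∀ᶠ x in 𝓝 (0 : ℂ), (s x).card = (s 0).card := by
    have hd := hsum (G := fun _ => 1) (fun z _ => analyticAt_const)
    have hc := (hd.differentiableAt (ball_mem_nhds 0 hδ)).continuousAt
    have := Metric.continuousAt_iff'.1 hc 1 one_pos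
    filter_upwards [this] with x hx
    simp only [Multiset.map_const', Multiset.sum_replicate, nsmul_eq_mul, mul_one,
      dist_eq_norm] at hx
    have h5 : ((((s x).card : ℤ) - ((s 0).card : ℤ) : ℤ) : ℂ) = (s x).card - (s 0).card := by
      push_cast; rfl
    rw [← h5, Complex.norm_intCast] at hx
    have h6 : |((s x).card : ℤ) - ((s 0).card : ℤ)| < 1 := by exact_mod_cast hx
    have := Int.abs_lt_one_iff.1 h6
    omega
  set k := (s 0).card with hk
  obtain ⟨δ', hδ', hδ'sub⟩ := Metric.eventually_nhds_iff_ball.1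
    (hcard.and (eventually_mem_set.2 (ball_mem_nhds (0 : ℂ) hδ)))
  have hv : ∀ x : ℂ, ∃ v : Fin k → ℂ, x ∈ ball (0 : ℂ) δ' → s x = Finset.univ.val.map v := by
    intro x
    by_cases hx : x ∈ ball (0 : ℂ) δ'
    · obtain ⟨v, hv⟩ := aux_multiset (s x) (hδ'sub x hx).1
      exact ⟨v, fun _ => hv⟩
    · exact ⟨0, fun h => absurd h hx⟩
  choose v hv using hv
  have hR : ∀ t : ℂ, DifferentiableOn ℂ (fun x => ∏ j, (g (x, v x j) + t * h (x, v x j)))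
      (ball 0 δ') := by
    intro t
    refine aux_newton_prod (fun x j => g (x, v x j) + t * h (x, v x j)) fun m => ?_
    have hd := hsum (G := fun z => (g z + t * h z) ^ m) (fun z hz =>
      ((hrsub z hz).2.1.add (analyticAt_const.mul (hrsub z hz).2.2.1)).pow m)
    refine (hd.mono fun x hx => (hδ'sub x hx).2).congr fun x hx => ?_
    simp only [hv x hx, Multiset.map_map]
    rfl
  have hroot : ∀ x ∈ ball (0 : ℂ) δ', ∀ w ∈ closedBall (0 : ℂ) ε,
      f (x, w) = 0 → ∃ j, v x j = w := by
    intro x hx w hw h0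
    obtain ⟨hs1, hs2, hs3, hs4⟩ := hsu x (hδ'sub x hx).2
    rw [hs4 w] at h0
    have h0 := (mul_eq_zero.1 h0).resolve_right (hs3 w hw)
    obtain ⟨a, ha, h0⟩ := Multiset.mem_map.1 (Multiset.prod_eq_zero_iff.1 h0)
    rw [hv x hx] at ha
    obtain ⟨j, -, hj⟩ := Multiset.mem_map.1 ha
    exact ⟨j, by rw [hj]; exact (sub_eq_zero.1 h0).symm⟩
  have hroot' : ∀ x ∈ ball (0 : ℂ) δ', ∀ j, v x j ∈ ball (0 : ℂ) ε ∧ f (x, v x j) = 0 := by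
    intro x hx j
    obtain ⟨hs1, hs2, hs3, hs4⟩ := hsu x (hδ'sub x hx).2
    have hmem : v x j ∈ s x := by
      rw [hv x hx]; exact Multiset.mem_map.2 ⟨j, Finset.mem_univ_val j, rfl⟩
    refine ⟨hs1 _ hmem, ?_⟩
    rw [hs4, Multiset.prod_eq_zero, zero_mul]
    exact Multiset.mem_map.2 ⟨v x j, hmem, sub_self _⟩
  have hdich : ∀ t : ℂ, _ := fun t =>
    ((hR t).analyticAt (ball_mem_nhds 0 hδ')).eventually_eq_zero_or_eventually_ne_zero
  by_cases hcase : ∃ t : ℂ, ∀ᶠ x in 𝓝[≠] (0 : ℂ), ∏ j, (g (x, v x j) + t * h (x, v x j)) ≠ 0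
  · obtain ⟨t, ht⟩ := hcase
    rw [eventually_nhdsWithin_iff] at ht ⊢
    have ht' : ∀ᶠ z : ℂ × ℂ in 𝓝 0, z.1 ∈ ({0}ᶜ : Set ℂ) →
        ∏ j, (g (z.1, v z.1 j) + t * h (z.1, v z.1 j)) ≠ 0 :=
      (continuous_fst.tendsto (0 : ℂ × ℂ)).eventually ht
    have hb1 : ∀ᶠ z : ℂ × ℂ in 𝓝 0, z.1 ∈ ball (0 : ℂ) δ' :=
      (continuous_fst.tendsto (0 : ℂ × ℂ)).eventually (ball_mem_nhds (0 : ℂ) hδ')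
    have hb2 : ∀ᶠ z : ℂ × ℂ in 𝓝 0, z.2 ∈ closedBall (0 : ℂ) ε :=
      (continuous_snd.tendsto (0 : ℂ × ℂ)).eventually (closedBall_mem_nhds (0 : ℂ) hε)
    filter_upwards [ht', hb1, hb2] with z hz hz1 hz2 hz0
    obtain ⟨x, w⟩ := z
    rintro ⟨hfz, hgz, hhz⟩
    simp only at *
    by_cases hx0 : x = 0
    · subst hx0
      refine hf0' w hz2 ?_ hfz
      rintro rfl
      exact hz0 rfl
    · obtain ⟨j, hj⟩ := hroot x hz1 w hz2 hfz
      refine hz hx0 (Finset.prod_eq_zero (Finset.mem_univ j) ?_)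
      rw [hj, hgz, hhz]; simp
  · exfalso
    have hall : ∀ᶠ x in 𝓝 (0 : ℂ), ∀ t : Fin (k + 1),
        ∏ j, (g (x, v x j) + ((t : ℕ) : ℂ) * h (x, v x j)) = 0 := by
      rw [eventually_all]
      intro t
      exact (hdich ((t : ℕ) : ℂ)).resolve_right fun h => hcase ⟨_, h⟩
    obtain ⟨ρ, hρ, hρsub⟩ := Metric.eventually_nhds_iff_ball.1
      (hall.and (eventually_mem_set.2 (ball_mem_nhds (0 : ℂ) hδ')))
    have hsub : ball (0 : ℂ) ρ ⊆ Prod.fst '' {z ∈ N | f z = 0 ∧ g z = 0 ∧ h z = 0} := by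
      intro x hx
      obtain ⟨hx1, hx2⟩ := hρsub x hx
      have : ∀ t : Fin (k + 1), ∃ j, g (x, v x j) + ((t : ℕ) : ℂ) * h (x, v x j) = 0 := by
        intro t
        obtain ⟨j, -, hj⟩ := Finset.prod_eq_zero_iff.1 (hx1 t)
        exact ⟨j, hj⟩
      choose J hJ using this
      obtain ⟨t, t', htt, hJJ⟩ := Fintype.exists_ne_map_eq_of_card_lt J (by simp)
      have e1 := hJ t
      have e2 := hJ t'
      rw [← hJJ] at e2
      have hne : ((t : ℕ) : ℂ) - ((t' : ℕ) : ℂ) ≠ 0 := by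
        rw [sub_ne_zero]
        intro h
        exact htt (Fin.ext (by exact_mod_cast h))
      have hh0 : h (x, v x (J t)) = 0 := by
        have : (((t : ℕ) : ℂ) - ((t' : ℕ) : ℂ)) * h (x, v x (J t)) = 0 := by
          linear_combination e1 - e2
        exact (mul_eq_zero.1 this).resolve_left hne
      have hg0 : g (x, v x (J t)) = 0 := by rw [hh0] at e1; simpa using e1
      obtain ⟨hw, hf'⟩ := hroot' x hx2 (J t)
      refine ⟨(x, v x (J t)), ⟨?_, hf', hg0, hh0⟩, rfl⟩
      exact (hrsub _ (hball x (hδsub x (hδ'sub x hx2).2).2 _ (ball_subset_closedBall hw))).2.2.2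
    have hcount : (ball (0 : ℂ) ρ).Countable := (hZ.image _).mono hsub
    obtain ⟨y, hy1, hy2⟩ := (hcount.dense_compl ℝ).exists_mem_open isOpen_ball
      ⟨(0 : ℂ), mem_ball_self hρ⟩
    exact hy1 hy2

theorem stmt_0 (U : Set (ℂ × ℂ)) (hU : IsOpen U) (h0U : (0 : ℂ × ℂ) ∈ U)
    (Φ : ℂ × ℂ → ℂ × ℂ × ℂ) (hΦ : AnalyticOn ℂ Φ U) (hΦ0 : Φ 0 = 0)
    (hinj : ∀ z ∈ U, z ≠ 0 → Function.Injective (fderiv ℂ Φ z)) :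
    ∃ r : ℝ, 0 < r ∧ ∀ z : ℂ × ℂ, 0 < ‖z‖ → ‖z‖ < r → Φ z ≠ 0 := by
  have hA : AnalyticOnNhd ℂ Φ U := hU.analyticOn_iff_analyticOnNhd.1 hΦ
  suffices H : ∀ᶠ z in 𝓝[≠] (0 : ℂ × ℂ), Φ z ≠ 0 by
    rw [eventually_nhdsWithin_iff] at H
    obtain ⟨r, hr, hsub⟩ := Metric.eventually_nhds_iff_ball.1 H
    exact ⟨r, hr, fun z hz hzr => hsub z (by simpa using hzr) (by simpa using hz)⟩
  -- countability of the fibre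
  have hZ0 : {z ∈ U | z ≠ 0 ∧ Φ z = 0}.Countable := by
    have hd : DiscreteTopology {z ∈ U | z ≠ 0 ∧ Φ z = 0} := by
      rw [discreteTopology_subtype_iff]
      rintro z ⟨hzU, hz0, hz⟩
      have h1 : ∀ᶠ y in 𝓝[≠] z, Φ y ≠ 0 := by
        refine (hA z hzU).differentiableAt.hasFDerivAt.eventually_ne ?_
        obtain ⟨K, -, hK⟩ := LinearMap.exists_antilipschitzWith
          ((fderiv ℂ Φ z : ℂ × ℂ →L[ℂ] ℂ × ℂ × ℂ) : ℂ × ℂ →ₗ[ℂ] ℂ × ℂ × ℂ)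
          (LinearMap.ker_eq_bot.2 (hinj z hzU hz0))
        exact ⟨K, hK⟩
      rw [inf_principal_eq_bot]
      filter_upwards [h1] with y hy hy'
      exact hy hy'.2.2
    exact TopologicalSpace.separableSpace_iff_countable.1 inferInstance
  have hZ : {z ∈ U | Φ z = 0}.Countable := by
    refine (hZ0.union (countable_singleton (0 : ℂ × ℂ))).mono ?_
    rintro z ⟨hz, hz'⟩
    by_cases h : z = 0
    · exact Or.inr h
    · exact Or.inl ⟨hz, h, hz'⟩
  have ha := hA 0 h0U
  have ha1 : AnalyticAt ℂ (fun z => (Φ z).1) 0 := analyticAt_fst.fun_comp ha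
  have ha23 : AnalyticAt ℂ (fun z => (Φ z).2) 0 := analyticAt_snd.fun_comp ha
  have ha2 : AnalyticAt ℂ (fun z => (Φ z).2.1) 0 := analyticAt_fst.fun_comp ha23
  have ha3 : AnalyticAt ℂ (fun z => (Φ z).2.2) 0 := analyticAt_snd.fun_comp ha23
  have hline : ∀ {G : ℂ × ℂ → ℂ}, AnalyticAt ℂ G 0 →
      (∀ᶠ w in 𝓝 (0 : ℂ), G (0, w) = 0) ∨ ∀ᶠ w in 𝓝[≠] (0 : ℂ), G (0, w) ≠ 0 := by
    intro G hG
    have : AnalyticAt ℂ (fun w : ℂ => G (0, w)) 0 :=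
      AnalyticAt.fun_comp (f := fun w : ℂ => ((0 : ℂ), w)) (x := 0) hG (by fun_prop)
    exact this.eventually_eq_zero_or_eventually_ne_zero
  have hcz : ∀ z, Φ z = 0 ↔ ((Φ z).1 = 0 ∧ (Φ z).2.1 = 0 ∧ (Φ z).2.2 = 0) := by
    intro z; simp [Prod.ext_iff]
  rcases hline ha1 with e1 | e1
  · rcases hline ha2 with e2 | e2
    · rcases hline ha3 with e3 | e3
      · exfalso
        have hUe : ∀ᶠ w in 𝓝 (0 : ℂ), ((0 : ℂ), w) ∈ U :=
          (Continuous.prodMk_right (0 : ℂ)).continuousAt.eventually (hU.mem_nhds h0U)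
        obtain ⟨ρ, hρ, hsub⟩ := Metric.eventually_nhds_iff_ball.1 (e1.and (e2.and (e3.and hUe)))
        have hb : ((ρ / 2 : ℝ) : ℂ) ∈ ball (0 : ℂ) ρ := by
          simp [abs_of_pos hρ]; linarith
        set w : ℂ := ((ρ / 2 : ℝ) : ℂ) with hw
        have hw0 : w ≠ 0 := by
          rw [hw]; exact_mod_cast (half_pos hρ).ne'
        have hwU := (hsub w hb).2.2.2
        have h2 : HasDerivAt (fun w : ℂ => ((0 : ℂ), w)) ((0 : ℂ), (1 : ℂ)) w :=
          (hasDerivAt_const w (0 : ℂ)).prodMk (hasDerivAt_id w)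
        have h3 : HasDerivAt (fun w : ℂ => Φ (0, w)) (fderiv ℂ Φ (0, w) (0, 1)) w :=
          (hA _ hwU).differentiableAt.hasFDerivAt.comp_hasDerivAt w h2
        have h4 : HasDerivAt (fun w : ℂ => Φ (0, w)) 0 w := by
          refine (hasDerivAt_const w (0 : ℂ × ℂ × ℂ)).congr_of_eventuallyEq ?_
          filter_upwards [isOpen_ball.mem_nhds hb] with y hy
          obtain ⟨y1, y2, y3, -⟩ := hsub y hy
          exact (hcz _).2 ⟨y1, y2, y3⟩
        have h5 := h3.unique h4
        have h6 := hinj (0, w) hwU (by simp [hw0]) (h5.trans (map_zero _).symm)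
        simp at h6
      · have := aux_core ha3 ha1 ha2 e3 (hU.mem_nhds h0U) (hZ.mono fun z hz =>
        (show z ∈ U ∧ Φ z = 0 from ⟨hz.1, (hcz z).2 ⟨hz.2.2.1, hz.2.2.2, hz.2.1⟩⟩))
        filter_upwards [this] with z hz hz'
        obtain ⟨a, b, c⟩ := (hcz z).1 hz'
        exact hz ⟨c, a, b⟩
    · have := aux_core ha2 ha1 ha3 e2 (hU.mem_nhds h0U) (hZ.mono fun z hz =>
        (show z ∈ U ∧ Φ z = 0 from ⟨hz.1, (hcz z).2 ⟨hz.2.2.1, hz.2.1, hz.2.2.2⟩⟩))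
      filter_upwards [this] with z hz hz'
      obtain ⟨a, b, c⟩ := (hcz z).1 hz'
      exact hz ⟨b, a, c⟩
  · have := aux_core ha1 ha2 ha3 e1 (hU.mem_nhds h0U) (hZ.mono fun z hz =>
        (show z ∈ U ∧ Φ z = 0 from ⟨hz.1, (hcz z).2 hz.2⟩))
    filter_upwards [this] with z hz hz'
    exact hz ((hcz z).1 hz')
end

section
/- Let R = ℂ[[s,t]] be the formal power series ring in two variables over ℂ. Let f₁, f₂, h ∈ R be such that f₁f₂ and h are relatively prime, i.e. no prime element of R divides both f₁f₂ and h. Then the sequence 0 → R/(f₂,h) → R/(f₁f₂,h) → R/(f₁,h) → 0 is exact, where the first map is induced by multiplication by f₁ and the second is the natural projection. Explicitly: multiplication by f₁ induces a well-defined injective R-linear map R/(f₂,h) → R/(f₁f₂,h); the natural projection R/(f₁f₂,h) → R/(f₁,h) is surjective; and the kernel of the projection equals the image of the multiplication-by-f₁ map. -/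
theorem aux_pid : IsPrincipalIdealRing (MvPowerSeries (Fin 1) ℂ) := by
  let e : PowerSeries ℂ ≃ₐ[ℂ] MvPowerSeries (Fin 1) ℂ :=
    MvPowerSeries.renameEquiv ℂ (Equiv.ofUnique Unit (Fin 1))
  exact IsPrincipalIdealRing.of_surjective e.toRingEquiv.toRingHom e.surjective

theorem aux_ufd : UniqueFactorizationMonoid (MvPowerSeries (Fin 2) ℂ) := by
  have := aux_pid
  have := NoZeroDivisors.to_isDomain (MvPowerSeries (Fin 1) ℂ)
  exact (MvPowerSeries.finSuccEquiv ℂ 1).symm.toMulEquiv.uniqueFactorizationMonoid inferInstance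

theorem aux_prime : ∃ p : MvPowerSeries (Fin 2) ℂ, Prime p := by
  have := NoZeroDivisors.to_isDomain (MvPowerSeries (Fin 1) ℂ)
  refine ⟨(MvPowerSeries.finSuccEquiv ℂ 1).symm.toMulEquiv PowerSeries.X, ?_⟩
  exact (MulEquiv.prime_iff (MvPowerSeries.finSuccEquiv ℂ 1).symm.toMulEquiv).mpr
    PowerSeries.X_prime

theorem aux_rel (f h : MvPowerSeries (Fin 2) ℂ)
    (hrel : ∀ p : MvPowerSeries (Fin 2) ℂ, Prime p → ¬(p ∣ f ∧ p ∣ h)) : IsRelPrime f h := by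
  have := aux_ufd
  refine WfDvdMonoid.isRelPrime_of_no_irreducible_factors ?_ ?_
  · rintro ⟨rfl, rfl⟩
    obtain ⟨p, hp⟩ := aux_prime
    exact hrel p hp ⟨dvd_zero _, dvd_zero _⟩
  · intro z hz h1 h2
    exact hrel z hz.prime ⟨h1, h2⟩

/-- Additivity of the local intersection number of plane curve germs
(exactness of `0 → R/(f₂,h) → R/(f₁f₂,h) → R/(f₁,h) → 0`, where the first map is
induced by multiplication by `f₁` and the second is the natural projection),
for `R = ℂ[[s,t]]` and `f₁f₂`, `h` relatively prime. -/
theorem stmt_1 (f₁ f₂ h : MvPowerSeries (Fin 2) ℂ)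
    (hrel : ∀ p : MvPowerSeries (Fin 2) ℂ, Prime p → ¬(p ∣ f₁ * f₂ ∧ p ∣ h)) :
    -- multiplication by `f₁` induces a well-defined map `R/(f₂,h) → R/(f₁f₂,h)` ...
    (∀ x y : MvPowerSeries (Fin 2) ℂ,
      Ideal.Quotient.mk (Ideal.span {f₂, h}) x = Ideal.Quotient.mk (Ideal.span {f₂, h}) y →
      Ideal.Quotient.mk (Ideal.span {f₁ * f₂, h}) (f₁ * x) =
        Ideal.Quotient.mk (Ideal.span {f₁ * f₂, h}) (f₁ * y)) ∧
    -- ... which is injective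
    (∀ x : MvPowerSeries (Fin 2) ℂ,
      Ideal.Quotient.mk (Ideal.span {f₁ * f₂, h}) (f₁ * x) = 0 →
      Ideal.Quotient.mk (Ideal.span {f₂, h}) x = 0) ∧
    -- the natural projection `R/(f₁f₂,h) → R/(f₁,h)` is well defined (and hence surjective)
    Ideal.span {f₁ * f₂, h} ≤ Ideal.span {f₁, h} ∧
    (∀ z : MvPowerSeries (Fin 2) ℂ ⧸ Ideal.span {f₁, h},
      ∃ x : MvPowerSeries (Fin 2) ℂ, Ideal.Quotient.mk (Ideal.span {f₁, h}) x = z) ∧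
    -- exactness in the middle: the kernel of the projection is the image of
    -- multiplication by `f₁`
    (∀ x : MvPowerSeries (Fin 2) ℂ,
      Ideal.Quotient.mk (Ideal.span {f₁, h}) x = 0 ↔
      ∃ y : MvPowerSeries (Fin 2) ℂ,
        Ideal.Quotient.mk (Ideal.span {f₁ * f₂, h}) x =
          Ideal.Quotient.mk (Ideal.span {f₁ * f₂, h}) (f₁ * y)) := by
  have := aux_ufd
  have hr : IsRelPrime f₁ h :=
    aux_rel f₁ h fun p hp hd => hrel p hp ⟨hd.1.mul_right _, hd.2⟩
  refine ⟨?_, ?_, ?_, Ideal.Quotient.mk_surjective, ?_⟩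
  · intro x y hxy
    rw [Ideal.Quotient.eq, Ideal.mem_span_pair] at hxy ⊢
    obtain ⟨a, b, hab⟩ := hxy
    exact ⟨a, f₁ * b, by linear_combination f₁ * hab⟩
  · intro x hx
    rw [Ideal.Quotient.eq_zero_iff_mem, Ideal.mem_span_pair] at hx ⊢
    obtain ⟨a, b, hab⟩ := hx
    by_cases h0 : f₁ = 0
    · subst h0
      obtain ⟨u, hu⟩ := (hr (dvd_zero h) dvd_rfl).exists_left_inv
      exact ⟨0, x * u, by linear_combination x * hu⟩
    · obtain ⟨c, hc⟩ : f₁ ∣ b :=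
        hr.dvd_of_dvd_mul_right ⟨x - a * f₂, by linear_combination hab⟩
      refine ⟨a, c, mul_left_cancel₀ h0 ?_⟩
      rw [hc] at hab
      linear_combination hab
  · rw [Ideal.span_le]
    rintro z (rfl | rfl)
    · exact Ideal.mul_mem_right _ _ (Ideal.subset_span (by simp))
    · exact Ideal.subset_span (by simp)
  · intro x
    simp only [Ideal.Quotient.eq, Ideal.Quotient.eq_zero_iff_mem, Ideal.mem_span_pair]
    constructor
    · rintro ⟨a, b, hab⟩
      exact ⟨a, 0, b, by linear_combination hab⟩
    · rintro ⟨y, a, b, hab⟩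
      exact ⟨a * f₂ + y, b, by linear_combination hab⟩
end

section
/- Fix an integer n ≥ 1 and let R = ℂ[[s,t]]. For the holomorphic germ Φ(s,t) = (s²t², s²ⁿ + t²ⁿ, st(s²ⁿ − t²ⁿ)) (the parametrization of the D_{n+2} quotient singularity), let J be the ideal of R generated by the three 2×2 minors of its Jacobian matrix, namely by 4n st(t²ⁿ − s²ⁿ), −4n s²t²(s²ⁿ + t²ⁿ), and 2n((s²ⁿ − t²ⁿ)² − 4n s²ⁿt²ⁿ). Then J equals the ideal (st(s²ⁿ − t²ⁿ), s²t²(s²ⁿ + t²ⁿ), (s²ⁿ − t²ⁿ)² − 4n s²ⁿt²ⁿ), and dim_ℂ R/J = 4n² + 12n − 1. -/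
noncomputable section

/-- `R = ℂ[[s,t]]`. -/
abbrev stmt6R : Type := MvPowerSeries (Fin 2) ℂ

/-- The variable `s`. -/
noncomputable def stmt6s : stmt6R := MvPowerSeries.X 0

/-- The variable `t`. -/
noncomputable def stmt6t : stmt6R := MvPowerSeries.X 1

/-- Normal form (in the basis of standard monomials) of the monomial `s^i t^j`. -/
def nf6 (m i j : ℕ) : (ℕ × ℕ) →₀ ℂ :=
  if i = 0 then
    (if j ≤ 2 * m then Finsupp.single (0, j) 1
      else if j = 2 * m + 1 then Finsupp.single (m, m + 1) (2 * (m : ℂ) + 1) else 0)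
  else if j = 0 then
    (if i < 2 * m then Finsupp.single (i, 0) 1
      else if i = 2 * m then Finsupp.single (m, m) (2 * (m : ℂ) + 2) - Finsupp.single (0, 2 * m) 1
      else if i = 2 * m + 1 then Finsupp.single (1, 2 * m) (2 * (m : ℂ) + 1) else 0)
  else if i ≤ m then
    (if j ≤ m + 1 ∨ (i = 1 ∧ j ≤ 2 * m) then Finsupp.single (i, j) 1 else 0)
  else
    (if (i = m + 1 ∧ j ≤ m) ∨ (i ≤ 2 * m ∧ j = 1) then Finsupp.single (i - m, j + m) 1 else 0)

/-- The standard monomials. -/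
def bas6 (m : ℕ) : Finset (ℕ × ℕ) :=
  (({0} ×ˢ Finset.range (2 * m + 1) ∪ Finset.Icc 1 (2 * m - 1) ×ˢ {0}) ∪
    Finset.Icc 1 m ×ˢ Finset.Icc 1 (m + 1)) ∪ {1} ×ˢ Finset.Icc (m + 2) (2 * m)

lemma mem_bas6 (m i j : ℕ) : (i, j) ∈ bas6 m ↔
    (i = 0 ∧ j < 2 * m + 1) ∨ (1 ≤ i ∧ i ≤ 2 * m - 1 ∧ j = 0) ∨
    (1 ≤ i ∧ i ≤ m ∧ 1 ≤ j ∧ j ≤ m + 1) ∨ (i = 1 ∧ m + 2 ≤ j ∧ j ≤ 2 * m) := by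
  simp only [bas6, Finset.mem_union, Finset.mem_product, Finset.mem_singleton,
    Finset.mem_range, Finset.mem_Icc]
  tauto

lemma card_bas6 (m : ℕ) (hm : 2 ≤ m) : (bas6 m).card = m ^ 2 + 6 * m - 1 := by
  rw [bas6, Finset.card_union_of_disjoint, Finset.card_union_of_disjoint,
    Finset.card_union_of_disjoint]
  · simp only [Finset.card_product, Finset.card_singleton, Finset.card_range, Nat.card_Icc]
    obtain ⟨k, rfl⟩ := Nat.exists_eq_add_of_le hm
    have h1 : 2 * (2 + k) - 1 + 1 - 1 = 2 * k + 3 := by omega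
    have h2 : 2 * (2 + k) + 1 - (2 + k + 2) = k + 1 := by omega
    have h3 : 2 + k + 1 - 1 = k + 2 := by omega
    have h4 : 2 + k + 1 + 1 - 1 = k + 3 := by omega
    rw [h1, h2, h3, h4]
    have h5 : (2 + k) ^ 2 + 6 * (2 + k) = (k ^ 2 + 10 * k + 15) + 1 := by ring
    rw [h5, Nat.add_sub_cancel]
    ring
  all_goals
    rw [Finset.disjoint_left]
    rintro ⟨i, j⟩
    simp only [Finset.mem_union, Finset.mem_product, Finset.mem_singleton,
      Finset.mem_range, Finset.mem_Icc]
    omega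

lemma nf6_bas (m : ℕ) (hm : 2 ≤ m) (i j : ℕ) (h : (i, j) ∈ bas6 m) :
    nf6 m i j = Finsupp.single (i, j) 1 := by
  rw [mem_bas6] at h
  unfold nf6
  split_ifs <;> first | contradiction | omega | (subst_vars; rfl)

lemma nf6_mem (m : ℕ) (hm : 2 ≤ m) (i j : ℕ) :
    nf6 m i j ∈ Finsupp.supported ℂ ℂ (bas6 m : Set (ℕ × ℕ)) := by
  have key : ∀ a b (c : ℂ), (a, b) ∈ bas6 m →
      Finsupp.single (a, b) c ∈ Finsupp.supported ℂ ℂ (bas6 m : Set (ℕ × ℕ)) :=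
    fun a b c h => Finsupp.single_mem_supported ℂ c (by exact_mod_cast h)
  unfold nf6
  split_ifs
  all_goals first
    | exact Submodule.zero_mem _
    | (apply Submodule.sub_mem <;> (apply key; rw [mem_bas6]; omega))
    | (apply key; rw [mem_bas6]; omega)

lemma nf6_big (m i j : ℕ) (hm : 2 ≤ m) (h : 2 * m + 2 ≤ i ∨ 2 * m + 2 ≤ j) : nf6 m i j = 0 := by
  unfold nf6
  split_ifs <;> first | contradiction | omega | rfl

lemma nf6_rel1 (m i j : ℕ) (hm : 2 ≤ m) : nf6 m (i + 1 + m) (j + 1) = nf6 m (i + 1) (j + 1 + m) := by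
  unfold nf6
  split_ifs <;> first | contradiction | omega | rfl | (congr 2 <;> omega)

lemma nf6_rel2 (m i j : ℕ) (hm : 2 ≤ m) : nf6 m (i + 2 + m) (j + 2) + nf6 m (i + 2) (j + 2 + m) = 0 := by
  have h1 : nf6 m (i + 2 + m) (j + 2) = 0 := by
    unfold nf6
    split_ifs <;> first | contradiction | omega | rfl
  have h2 : nf6 m (i + 2) (j + 2 + m) = 0 := by
    unfold nf6
    split_ifs <;> first | contradiction | omega | rfl
  rw [h1, h2, add_zero]

lemma nf6_rel3 (m i j : ℕ) (hm : 2 ≤ m) :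
    nf6 m (i + 2 * m) j + nf6 m i (j + 2 * m) = (2 * m + 2 : ℂ) • nf6 m (i + m) (j + m) := by
  rcases Nat.eq_zero_or_pos i with rfl | hi
  · rcases Nat.eq_zero_or_pos j with rfl | hj
    · have h1 : nf6 m (m) (m) = Finsupp.single (m, m) 1 :=
        nf6_bas m hm _ _ (by rw [mem_bas6]; omega)
      have h2 : nf6 m 0 (2 * m) = Finsupp.single (0, 2 * m) 1 :=
        nf6_bas m hm _ _ (by rw [mem_bas6]; omega)
      have h3 : nf6 m (2 * m) 0 =
          Finsupp.single (m, m) (2 * (m : ℂ) + 2) - Finsupp.single (0, 2 * m) 1 := by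
        unfold nf6
        rw [if_neg (by omega), if_pos rfl, if_neg (by omega), if_pos rfl]
      simp only [zero_add, h1, h2, h3, Finsupp.smul_single, smul_eq_mul, mul_one, sub_add_cancel]
    · by_cases hj1 : j = 1
      · subst hj1
        have h1 : nf6 m (0 + m) (1 + m) = Finsupp.single (m, m + 1) 1 := by
          rw [zero_add, add_comm 1 m]
          exact nf6_bas m hm _ _ (by rw [mem_bas6]; omega)
        have h2 : nf6 m (0 + 2 * m) 1 = Finsupp.single (m, m + 1) 1 := by
          unfold nf6
          rw [if_neg (by omega), if_neg (by omega), if_neg (by omega), if_pos (by omega)]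
          congr 2 <;> omega
        have h3 : nf6 m 0 (1 + 2 * m) = Finsupp.single (m, m + 1) (2 * (m : ℂ) + 1) := by
          unfold nf6
          rw [if_pos rfl, if_neg (by omega), if_pos (by omega)]
        rw [h1, h2, h3, ← Finsupp.single_add, Finsupp.smul_single]
        congr 1
        simp only [smul_eq_mul]
        ring
      · have h1 : nf6 m (0 + m) (j + m) = 0 := by
          unfold nf6
          split_ifs <;> first | contradiction | omega | rfl
        have h2 : nf6 m (0 + 2 * m) j = 0 := by
          unfold nf6
          split_ifs <;> first | contradiction | omega | rfl
        have h3 : nf6 m 0 (j + 2 * m) = 0 := by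
          unfold nf6
          split_ifs <;> first | contradiction | omega | rfl
        rw [h1, h2, h3, smul_zero, add_zero]
  · by_cases hij : i = 1 ∧ j = 0
    · obtain ⟨rfl, rfl⟩ := hij
      have h1 : nf6 m (1 + m) (0 + m) = Finsupp.single (1, 2 * m) 1 := by
        unfold nf6
        rw [if_neg (by omega), if_neg (by omega), if_neg (by omega), if_pos (by omega)]
        congr 2 <;> omega
      have h2 : nf6 m 1 (0 + 2 * m) = Finsupp.single (1, 2 * m) 1 := by
        rw [zero_add]
        exact nf6_bas m hm _ _ (by rw [mem_bas6]; omega)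
      have h3 : nf6 m (1 + 2 * m) 0 = Finsupp.single (1, 2 * m) (2 * (m : ℂ) + 1) := by
        unfold nf6
        rw [if_neg (by omega), if_pos rfl, if_neg (by omega), if_neg (by omega),
          if_pos (by omega)]
      rw [h1, h2, h3, ← Finsupp.single_add, Finsupp.smul_single]
      congr 1
      simp only [smul_eq_mul]
      ring
    · have h1 : nf6 m (i + m) (j + m) = 0 := by
        unfold nf6
        split_ifs <;> first | contradiction | omega | rfl
      have h2 : nf6 m (i + 2 * m) j = 0 := by
        unfold nf6
        split_ifs <;> first | contradiction | omega | rfl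
      have h3 : nf6 m i (j + 2 * m) = 0 := by
        unfold nf6
        split_ifs <;> first | contradiction | omega | rfl
      rw [h1, h2, h3, smul_zero, add_zero]

/-- In any `ℂ`-algebra where the relations hold, monomials equal their normal forms. -/
lemma nf6_eval {A : Type*} [CommRing A] [Algebra ℂ A] (m : ℕ) (hm : 2 ≤ m) (s t : A)
    (h1 : s * t * (s ^ m - t ^ m) = 0) (h2 : s ^ 2 * t ^ 2 * (s ^ m + t ^ m) = 0)
    (h3 : (s ^ m - t ^ m) ^ 2 - ((2 * m : ℕ) : A) * s ^ m * t ^ m = 0) (i j : ℕ) :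
    s ^ i * t ^ j =
      Finsupp.linearCombination ℂ (fun p : ℕ × ℕ => s ^ p.1 * t ^ p.2) (nf6 m i j) := by
  have hdiv : ∀ (c : ℕ) (x : A), c ≠ 0 → (c : A) * x = 0 → x = 0 := by
    intro c x hc hx
    have hx' : (c : ℂ) • x = 0 := by
      rw [Algebra.smul_def, map_natCast, hx]
    exact (smul_eq_zero_iff_right (Nat.cast_ne_zero.mpr hc)).mp hx'
  obtain ⟨k, rfl⟩ := Nat.exists_eq_add_of_le' hm
  push_cast at h3
  have e1 : s ^ (k + 2 + 1) * t = s * t ^ (k + 2 + 1) := by linear_combination h1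
  have e2 : s ^ 2 * t ^ (k + 2 + 2) = 0 := by
    apply hdiv 2 _ (by norm_num)
    push_cast
    linear_combination h2 - s * t * h1
  have e2' : s ^ (k + 2 + 2) * t ^ 2 = 0 := by
    linear_combination e2 + s * t * h1
  have e4 : s ^ (2 * (k + 2) + 1) = (2 * (k + 2 : ℕ) + 1 : A) * (s * t ^ (2 * (k + 2))) := by
    push_cast
    linear_combination s * h3 + (2 * k + 6) * t ^ (k + 1) * e1
  have e5 : t ^ (2 * (k + 2) + 1) = (2 * (k + 2 : ℕ) + 1 : A) * (s ^ (k + 2) * t ^ (k + 2 + 1)) := by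
    push_cast
    linear_combination t * h3 - s ^ (k + 1) * e1
  have e6 : s ^ (k + 2 + 1) * t ^ (k + 2 + 1) = 0 := by
    apply hdiv (2 * (k + 2)) _ (by omega)
    push_cast at e4 ⊢
    linear_combination - t * e4 + s ^ (k + 2) * e1 + (2 * k + 5) * t ^ (k + 2) * e1
  have e7 : s ^ (2 * (k + 2) + 1) * t = 0 := by
    linear_combination e6 + s ^ (k + 2) * e1
  have e7' : s * t ^ (2 * (k + 2) + 1) = 0 := by
    linear_combination e6 - t ^ (k + 2) * e1
  have e8 : s ^ (2 * (k + 2) + 2) = 0 := by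
    linear_combination s * e4 + (2 * (k + 2 : ℕ) + 1 : A) * t ^ k * e2
  have e8' : t ^ (2 * (k + 2) + 2) = 0 := by
    linear_combination t * e5 + (2 * (k + 2 : ℕ) + 1 : A) * s ^ k * e2
  have hz : ∀ a b, s ^ a * t ^ b = 0 → a ≤ i → b ≤ j → s ^ i * t ^ j = 0 := by
    intro a b h ha hb
    obtain ⟨c, rfl⟩ := Nat.exists_eq_add_of_le ha
    obtain ⟨d, rfl⟩ := Nat.exists_eq_add_of_le hb
    linear_combination s ^ c * t ^ d * h
  unfold nf6
  split_ifs with c1 c2 c3 c4 c5 c6 c7 c8 c9 c10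
  · simp [c1]
  · subst c1 c3
    rw [Finsupp.linearCombination_single, Algebra.smul_def]
    simp only [map_add, map_mul, map_natCast, map_ofNat, map_one, pow_zero, one_mul]
    exact e5
  · rw [map_zero]
    exact hz 0 (2 * (k + 2) + 2) (by simpa using e8') (by omega) (by omega)
  · simp [c4]
  · subst c4 c6
    rw [map_sub, Finsupp.linearCombination_single, Finsupp.linearCombination_single,
      Algebra.smul_def]
    simp only [map_add, map_mul, map_natCast, map_ofNat, map_one, pow_zero, one_mul, one_smul]
    push_cast
    linear_combination h3
  · subst c4 c7
    rw [Finsupp.linearCombination_single, Algebra.smul_def]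
    simp only [map_add, map_mul, map_natCast, map_ofNat, map_one, pow_zero, mul_one, pow_one]
    exact e4
  · rw [map_zero]
    exact hz (2 * (k + 2) + 2) 0 (by simpa using e8) (by omega) (by omega)
  · simp
  · rw [map_zero]
    by_cases hi : i = 1
    · exact hz 1 (2 * (k + 2) + 1) (by simpa using e7') (by omega) (by omega)
    · exact hz _ _ e2 (by omega) (by omega)
  · rw [Finsupp.linearCombination_single, one_smul]
    obtain ⟨a, rfl⟩ := Nat.exists_eq_add_of_le (show k + 2 + 1 ≤ i by omega)
    obtain ⟨b, rfl⟩ := Nat.exists_eq_add_of_le (show 1 ≤ j by omega)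
    have : k + 2 + 1 + a - (k + 2) = a + 1 := by omega
    simp only [this]
    linear_combination s ^ a * t ^ b * e1
  · rw [map_zero]
    by_cases hi : i = k + 2 + 1
    · exact hz _ _ e6 (by omega) (by omega)
    · by_cases hj : j = 1
      · exact hz (2 * (k + 2) + 1) 1 (by simpa using e7) (by omega) (by omega)
      · exact hz _ _ e2' (by omega) (by omega)

/-- The exponent `(i, j)`. -/
def ex6 (i j : ℕ) : Fin 2 →₀ ℕ := Finsupp.single 0 i + Finsupp.single 1 j

lemma ex6_zero (i j : ℕ) : ex6 i j 0 = i := by simp [ex6]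
lemma ex6_one (i j : ℕ) : ex6 i j 1 = j := by simp [ex6]
lemma ex6_eta (e : Fin 2 →₀ ℕ) : ex6 (e 0) (e 1) = e := by
  ext x
  fin_cases x
  · exact ex6_zero _ _
  · exact ex6_one _ _
lemma ex6_inj {i j a b : ℕ} : ex6 i j = ex6 a b ↔ i = a ∧ j = b := by
  constructor
  · intro h
    have h0 := DFunLike.congr_fun h 0
    have h1 := DFunLike.congr_fun h 1
    rw [ex6_zero, ex6_zero] at h0
    rw [ex6_one, ex6_one] at h1
    exact ⟨h0, h1⟩
  · rintro ⟨rfl, rfl⟩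
    rfl

lemma mono6 (i j : ℕ) : stmt6s ^ i * stmt6t ^ j = MvPowerSeries.monomial (ex6 i j) (1 : ℂ) := by
  rw [stmt6s, stmt6t, MvPowerSeries.X_pow_eq, MvPowerSeries.X_pow_eq,
    MvPowerSeries.monomial_mul_monomial, one_mul, ex6]

/-- Box truncation plus remainder. -/
lemma decomp6 (K : ℕ) (f : stmt6R) : ∃ g h : stmt6R,
    f = (∑ i ∈ Finset.range K, ∑ j ∈ Finset.range K,
      MvPowerSeries.coeff (ex6 i j) f • (stmt6s ^ i * stmt6t ^ j)) +
      stmt6s ^ K * g + stmt6t ^ K * h := by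
  classical
  set T : stmt6R := ∑ i ∈ Finset.range K, ∑ j ∈ Finset.range K,
      MvPowerSeries.coeff (ex6 i j) f • (stmt6s ^ i * stmt6t ^ j) with hT
  have hTc : ∀ e : Fin 2 →₀ ℕ, e 0 < K → e 1 < K →
      MvPowerSeries.coeff e T = MvPowerSeries.coeff e f := by
    intro e h0 h1
    rw [hT]
    simp only [map_sum, mono6, map_smul, MvPowerSeries.coeff_monomial, smul_eq_mul]
    rw [Finset.sum_eq_single (e 0), Finset.sum_eq_single (e 1)]
    · rw [ex6_eta, if_pos rfl, mul_one]
    · intro b _ hb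
      rw [if_neg, mul_zero]
      intro h
      exact hb (by rw [h, ex6_one])
    · intro h
      exact absurd (Finset.mem_range.mpr h1) h
    · intro b _ hb
      apply Finset.sum_eq_zero
      intro c _
      rw [if_neg, mul_zero]
      intro h
      exact hb (by rw [h, ex6_zero])
    · intro h
      exact absurd (Finset.mem_range.mpr h0) h
  let r1 : stmt6R := fun e => if K ≤ e 0 then MvPowerSeries.coeff e (f - T) else 0
  have hr1 : ∀ e, MvPowerSeries.coeff e r1 =
      if K ≤ e 0 then MvPowerSeries.coeff e (f - T) else 0 := fun e => rfl
  have d1 : stmt6s ^ K ∣ r1 := by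
    rw [stmt6s, MvPowerSeries.X_pow_dvd_iff]
    intro e he
    rw [hr1, if_neg (by omega)]
  have d2 : stmt6t ^ K ∣ f - T - r1 := by
    rw [stmt6t, MvPowerSeries.X_pow_dvd_iff]
    intro e he
    rw [map_sub, hr1]
    split_ifs with h
    · exact sub_self _
    · rw [map_sub, hTc e (by omega) he, sub_self, sub_zero]
  obtain ⟨g, hg⟩ := d1
  obtain ⟨h, hh⟩ := d2
  refine ⟨g, h, ?_⟩
  rw [← hg, ← hh]
  ring

/-- Normal form map. -/
def L6 (m : ℕ) : stmt6R →ₗ[ℂ] ((ℕ × ℕ) →₀ ℂ) :=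
  ∑ i ∈ Finset.range (2 * m + 2), ∑ j ∈ Finset.range (2 * m + 2),
    (MvPowerSeries.coeff (R := ℂ) (ex6 i j)).smulRight (nf6 m i j)

lemma L6_apply (m : ℕ) (f : stmt6R) : L6 m f =
    ∑ i ∈ Finset.range (2 * m + 2), ∑ j ∈ Finset.range (2 * m + 2),
      MvPowerSeries.coeff (ex6 i j) f • nf6 m i j := by
  simp [L6, LinearMap.sum_apply]

lemma L6_mono (m : ℕ) (hm : 2 ≤ m) (a b : ℕ) : L6 m (stmt6s ^ a * stmt6t ^ b) = nf6 m a b := by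
  classical
  rw [L6_apply]
  simp only [mono6, MvPowerSeries.coeff_monomial, ex6_inj]
  by_cases h : 2 * m + 2 ≤ a ∨ 2 * m + 2 ≤ b
  · rw [nf6_big m a b hm h]
    apply Finset.sum_eq_zero
    intro i hi
    apply Finset.sum_eq_zero
    intro j hj
    rw [Finset.mem_range] at hi hj
    rw [if_neg (by omega), zero_smul]
  · push Not at h
    rw [Finset.sum_eq_single a, Finset.sum_eq_single b]
    · simp
    · intro j _ hj
      rw [if_neg (by tauto), zero_smul]
    · intro h'
      exact absurd (Finset.mem_range.mpr h.2) h'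
    · intro i _ hi
      apply Finset.sum_eq_zero
      intro j _
      rw [if_neg (by tauto), zero_smul]
    · intro h'
      exact absurd (Finset.mem_range.mpr h.1) h'

lemma L6_s (m : ℕ) (f : stmt6R) : L6 m (stmt6s ^ (2 * m + 2) * f) = 0 := by
  rw [L6_apply]
  apply Finset.sum_eq_zero
  intro i hi
  apply Finset.sum_eq_zero
  intro j hj
  have := (MvPowerSeries.X_pow_dvd_iff (R := ℂ) (s := (0 : Fin 2)) (n := 2 * m + 2)
    (φ := stmt6s ^ (2 * m + 2) * f)).mp (Dvd.intro _ rfl) (ex6 i j)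
    (by rw [ex6_zero]; exact Finset.mem_range.mp hi)
  rw [this, zero_smul]

lemma L6_t (m : ℕ) (f : stmt6R) : L6 m (stmt6t ^ (2 * m + 2) * f) = 0 := by
  rw [L6_apply]
  apply Finset.sum_eq_zero
  intro i hi
  apply Finset.sum_eq_zero
  intro j hj
  have := (MvPowerSeries.X_pow_dvd_iff (R := ℂ) (s := (1 : Fin 2)) (n := 2 * m + 2)
    (φ := stmt6t ^ (2 * m + 2) * f)).mp (Dvd.intro _ rfl) (ex6 i j)
    (by rw [ex6_one]; exact Finset.mem_range.mp hj)
  rw [this, zero_smul]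

lemma L6_mul (m : ℕ) (g : stmt6R)
    (hg : ∀ i j, L6 m (stmt6s ^ i * stmt6t ^ j * g) = 0) (f : stmt6R) : L6 m (f * g) = 0 := by
  obtain ⟨a, b, h⟩ := decomp6 (2 * m + 2) f
  rw [h, add_mul, add_mul, map_add, map_add, mul_assoc, mul_assoc, L6_s, L6_t, add_zero, add_zero,
    Finset.sum_mul, map_sum]
  apply Finset.sum_eq_zero
  intro i _
  rw [Finset.sum_mul, map_sum]
  apply Finset.sum_eq_zero
  intro j _
  rw [smul_mul_assoc, map_smul, hg, smul_zero]

/-- The simplified ideal. -/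
def J6 (m : ℕ) : Ideal stmt6R :=
  Ideal.span {stmt6s * stmt6t * (stmt6s ^ m - stmt6t ^ m),
        stmt6s ^ 2 * stmt6t ^ 2 * (stmt6s ^ m + stmt6t ^ m),
        (stmt6s ^ m - stmt6t ^ m) ^ 2 -
          ((2 * m : ℕ) : stmt6R) * stmt6s ^ m * stmt6t ^ m}

lemma J6_le (m : ℕ) (hm : 2 ≤ m) (f : stmt6R) (hf : f ∈ J6 m) : L6 m f = 0 := by
  rw [J6] at hf
  obtain ⟨a, z, hz, rfl⟩ := Ideal.mem_span_insert.mp hf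
  obtain ⟨b, w, hw, rfl⟩ := Ideal.mem_span_insert.mp hz
  obtain ⟨c, rfl⟩ := Ideal.mem_span_singleton'.mp hw
  rw [map_add, map_add, L6_mul, L6_mul, L6_mul, add_zero, add_zero]
  · intro i j
    have : stmt6s ^ i * stmt6t ^ j * ((stmt6s ^ m - stmt6t ^ m) ^ 2 -
          ((2 * m : ℕ) : stmt6R) * stmt6s ^ m * stmt6t ^ m) =
        (stmt6s ^ (i + 2 * m) * stmt6t ^ j + stmt6s ^ i * stmt6t ^ (j + 2 * m)) -
          (2 * m + 2 : ℂ) • (stmt6s ^ (i + m) * stmt6t ^ (j + m)) := by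
      rw [Algebra.smul_def]
      simp only [map_add, map_mul, map_natCast, map_ofNat]
      push_cast
      ring
    rw [this, map_sub, map_add, map_smul, L6_mono m hm, L6_mono m hm, L6_mono m hm,
      nf6_rel3 m i j hm, sub_self]
  · intro i j
    have : stmt6s ^ i * stmt6t ^ j * (stmt6s ^ 2 * stmt6t ^ 2 * (stmt6s ^ m + stmt6t ^ m)) =
        stmt6s ^ (i + 2 + m) * stmt6t ^ (j + 2) + stmt6s ^ (i + 2) * stmt6t ^ (j + 2 + m) := by
      ring
    rw [this, map_add, L6_mono m hm, L6_mono m hm, nf6_rel2 m i j hm]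
  · intro i j
    have : stmt6s ^ i * stmt6t ^ j * (stmt6s * stmt6t * (stmt6s ^ m - stmt6t ^ m)) =
        stmt6s ^ (i + 1 + m) * stmt6t ^ (j + 1) - stmt6s ^ (i + 1) * stmt6t ^ (j + 1 + m) := by
      ring
    rw [this, map_sub, L6_mono m hm, L6_mono m hm, nf6_rel1 m i j hm, sub_self]

lemma Ideal.mem_of_eq6 {I : Ideal stmt6R} {x y : stmt6R} (c : stmt6R) (hy : y ∈ I)
    (h : x = c * y) : x ∈ I := h ▸ I.mul_mem_left c hy

lemma le_J6 (m : ℕ) (hm : 2 ≤ m) (f : stmt6R) (hf : L6 m f = 0) : f ∈ J6 m := by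
  let q : stmt6R →ₐ[ℂ] (stmt6R ⧸ J6 m) := Ideal.Quotient.mkₐ ℂ (J6 m)
  have hq : ∀ x, x ∈ J6 m → q x = 0 := fun x hx => Ideal.Quotient.eq_zero_iff_mem.mpr hx
  have ev := nf6_eval (A := stmt6R ⧸ J6 m) m hm (q stmt6s) (q stmt6t)
    (by simpa using hq _ (Ideal.subset_span (Or.inl rfl)))
    (by simpa using hq _ (Ideal.subset_span (Or.inr (Or.inl rfl))))
    (by
      have h := hq _ (Ideal.subset_span (Or.inr (Or.inr rfl)))
      simp only [map_sub, map_mul, map_pow, map_natCast] at h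
      exact h)
  have es : q stmt6s ^ (2 * m + 2) = 0 := by
    have := ev (2 * m + 2) 0
    rwa [nf6_big _ _ _ hm (Or.inl le_rfl), map_zero, pow_zero, mul_one] at this
  have et : q stmt6t ^ (2 * m + 2) = 0 := by
    have := ev 0 (2 * m + 2)
    rwa [nf6_big _ _ _ hm (Or.inr le_rfl), map_zero, pow_zero, one_mul] at this
  have key : q f = Finsupp.linearCombination ℂ
      (fun p : ℕ × ℕ => q stmt6s ^ p.1 * q stmt6t ^ p.2) (L6 m f) := by
    obtain ⟨a, b, h⟩ := decomp6 (2 * m + 2) f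
    rw [L6_apply]
    conv_lhs => rw [h]
    simp only [map_add, map_mul, map_pow, map_sum, map_smul, es, et, zero_mul, add_zero]
    exact Finset.sum_congr rfl fun i _ => Finset.sum_congr rfl fun j _ => by rw [ev i j]
  rw [hf, map_zero] at key
  exact Ideal.Quotient.eq_zero_iff_mem.mp key

lemma finrank6 (m : ℕ) (hm : 2 ≤ m) :
    Module.finrank ℂ (stmt6R ⧸ J6 m) = m ^ 2 + 6 * m - 1 := by
  have hker : LinearMap.ker (L6 m) = (J6 m).restrictScalars ℂ := by
    ext f
    rw [LinearMap.mem_ker, Submodule.restrictScalars_mem]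
    exact ⟨le_J6 m hm f, J6_le m hm f⟩
  have hrange : LinearMap.range (L6 m) = Finsupp.supported ℂ ℂ (bas6 m : Set (ℕ × ℕ)) := by
    apply le_antisymm
    · rintro _ ⟨f, rfl⟩
      rw [L6_apply]
      exact Submodule.sum_mem _ fun i _ => Submodule.sum_mem _ fun j _ =>
        Submodule.smul_mem _ _ (nf6_mem m hm i j)
    · rw [Finsupp.supported_eq_span_single, Submodule.span_le]
      rintro _ ⟨⟨i, j⟩, hij, rfl⟩
      exact ⟨stmt6s ^ i * stmt6t ^ j, by
        rw [L6_mono m hm, nf6_bas m hm i j (by exact_mod_cast hij)]⟩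
  have e1 : (stmt6R ⧸ J6 m) ≃ₗ[ℂ] (stmt6R ⧸ LinearMap.ker (L6 m)) :=
    (Submodule.Quotient.restrictScalarsEquiv ℂ (J6 m)).symm.trans
      (Submodule.quotEquivOfEq _ _ hker.symm)
  rw [(e1.trans (L6 m).quotKerEquivRange).finrank_eq, hrange,
    (Finsupp.supportedEquivFinsupp (M := ℂ) (R := ℂ) (bas6 m : Set (ℕ × ℕ))).finrank_eq,
    Module.finrank_finsupp_self]
  simp [card_bas6 m hm]

/-- For the `D_{n+2}` germ `Φ(s,t) = (s²t², s²ⁿ + t²ⁿ, st(s²ⁿ − t²ⁿ))`, the Jacobian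
minor ideal `J = (4n st(t²ⁿ − s²ⁿ), −4n s²t²(s²ⁿ + t²ⁿ), 2n((s²ⁿ − t²ⁿ)² − 4n s²ⁿt²ⁿ))`
of `R = ℂ[[s,t]]` equals `(st(s²ⁿ − t²ⁿ), s²t²(s²ⁿ + t²ⁿ), (s²ⁿ − t²ⁿ)² − 4n s²ⁿt²ⁿ)`
and has codimension `4n² + 12n − 1`. -/
theorem stmt_6 (n : ℕ) (hn : 1 ≤ n) :
    (Ideal.span {((4 * n : ℕ) : stmt6R) * stmt6s * stmt6t *
          (stmt6t ^ (2 * n) - stmt6s ^ (2 * n)),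
        -(((4 * n : ℕ) : stmt6R) * stmt6s ^ 2 * stmt6t ^ 2 *
          (stmt6s ^ (2 * n) + stmt6t ^ (2 * n))),
        ((2 * n : ℕ) : stmt6R) * ((stmt6s ^ (2 * n) - stmt6t ^ (2 * n)) ^ 2 -
          ((4 * n : ℕ) : stmt6R) * stmt6s ^ (2 * n) * stmt6t ^ (2 * n))} =
      Ideal.span {stmt6s * stmt6t * (stmt6s ^ (2 * n) - stmt6t ^ (2 * n)),
        stmt6s ^ 2 * stmt6t ^ 2 * (stmt6s ^ (2 * n) + stmt6t ^ (2 * n)),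
        (stmt6s ^ (2 * n) - stmt6t ^ (2 * n)) ^ 2 -
          ((4 * n : ℕ) : stmt6R) * stmt6s ^ (2 * n) * stmt6t ^ (2 * n)}) ∧
    Module.finrank ℂ
      (stmt6R ⧸
        Ideal.span {((4 * n : ℕ) : stmt6R) * stmt6s * stmt6t *
            (stmt6t ^ (2 * n) - stmt6s ^ (2 * n)),
          -(((4 * n : ℕ) : stmt6R) * stmt6s ^ 2 * stmt6t ^ 2 *
            (stmt6s ^ (2 * n) + stmt6t ^ (2 * n))),
          ((2 * n : ℕ) : stmt6R) * ((stmt6s ^ (2 * n) - stmt6t ^ (2 * n)) ^ 2 -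
            ((4 * n : ℕ) : stmt6R) * stmt6s ^ (2 * n) * stmt6t ^ (2 * n))}) =
      4 * n ^ 2 + 12 * n - 1 := by
  have hJ : (Ideal.span {((4 * n : ℕ) : stmt6R) * stmt6s * stmt6t *
          (stmt6t ^ (2 * n) - stmt6s ^ (2 * n)),
        -(((4 * n : ℕ) : stmt6R) * stmt6s ^ 2 * stmt6t ^ 2 *
          (stmt6s ^ (2 * n) + stmt6t ^ (2 * n))),
        ((2 * n : ℕ) : stmt6R) * ((stmt6s ^ (2 * n) - stmt6t ^ (2 * n)) ^ 2 -
          ((4 * n : ℕ) : stmt6R) * stmt6s ^ (2 * n) * stmt6t ^ (2 * n))} =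
      Ideal.span {stmt6s * stmt6t * (stmt6s ^ (2 * n) - stmt6t ^ (2 * n)),
        stmt6s ^ 2 * stmt6t ^ 2 * (stmt6s ^ (2 * n) + stmt6t ^ (2 * n)),
        (stmt6s ^ (2 * n) - stmt6t ^ (2 * n)) ^ 2 -
          ((4 * n : ℕ) : stmt6R) * stmt6s ^ (2 * n) * stmt6t ^ (2 * n)}) := by
    have hinv : ∀ c : ℕ, c ≠ 0 → ∃ d : stmt6R, d * (c : stmt6R) = 1 := by
      intro c hc
      refine ⟨algebraMap ℂ stmt6R ((c : ℂ)⁻¹), ?_⟩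
      rw [← map_natCast (algebraMap ℂ stmt6R) c, ← map_mul,
        inv_mul_cancel₀ (Nat.cast_ne_zero.mpr hc), map_one]
    obtain ⟨d4, h4⟩ := hinv (4 * n) (by omega)
    obtain ⟨d2, h2⟩ := hinv (2 * n) (by omega)
    apply le_antisymm
    · rw [Ideal.span_le]
      rintro x (rfl | rfl | rfl)
      · exact Ideal.mem_of_eq6 (-((4 * n : ℕ) : stmt6R)) (Ideal.subset_span (Or.inl rfl)) (by ring)
      · exact Ideal.mem_of_eq6 (-((4 * n : ℕ) : stmt6R))
          (Ideal.subset_span (Or.inr (Or.inl rfl))) (by ring)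
      · exact Ideal.mem_of_eq6 (((2 * n : ℕ) : stmt6R))
          (Ideal.subset_span (Or.inr (Or.inr rfl))) (by ring)
    · rw [Ideal.span_le]
      rintro x (rfl | rfl | rfl)
      · exact Ideal.mem_of_eq6 (-d4) (Ideal.subset_span (Or.inl rfl))
          (by linear_combination -stmt6s * stmt6t * (stmt6s ^ (2 * n) - stmt6t ^ (2 * n)) * h4)
      · exact Ideal.mem_of_eq6 (-d4) (Ideal.subset_span (Or.inr (Or.inl rfl)))
          (by
            set u := stmt6s ^ (2 * n) + stmt6t ^ (2 * n)
            linear_combination (-stmt6s ^ 2 * stmt6t ^ 2 * u) * h4)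
      · exact Ideal.mem_of_eq6 d2 (Ideal.subset_span (Or.inr (Or.inr rfl)))
          (by rw [← mul_assoc, h2, one_mul])
  refine ⟨hJ, ?_⟩
  rw [hJ]
  have h := finrank6 (2 * n) (by omega)
  rw [J6, show 2 * (2 * n) = 4 * n by ring] at h
  rw [h]
  congr 1
  ring

end
end

section
/- Let w₁, w₂ ≥ 1 be integers and let g₁, g₂, g₃ ∈ ℂ[s,t] be polynomials in two variables, where each g_i is weighted homogeneous of degree d_i ≥ 1 with respect to the weights (w₁, w₂) (every monomial s^a t^b occurring in g_i satisfies a·w₁ + b·w₂ = d_i). Let J ⊆ R = ℂ[[s,t]] be the ideal generated by the power-series images of the three 2×2 minors ∂_s g_i ∂_t g_j − ∂_t g_i ∂_s g_j (1 ≤ i < j ≤ 3) of the Jacobian matrix of (g₁,g₂,g₃). If R/J is a finite-dimensional ℂ-vector space, then w₁·w₂·dim_ℂ(R/J) = d₁d₂ + d₂d₃ + d₃d₁ − (w₁+w₂)(d₁+d₂+d₃−w₁−w₂) − w₁w₂. -/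
namespace CrossCap

open MvPolynomial

/-- the polynomial ring -/
abbrev S := MvPolynomial (Fin 2) ℂ
/-- the power series ring -/
abbrev R := MvPowerSeries (Fin 2) ℂ

/-- integer weights -/
def wt (a b : ℕ) : Fin 2 → ℤ := ![(a : ℤ), (b : ℤ)]

/-- graded pieces, integer degrees -/
noncomputable def V (a b : ℕ) (n : ℤ) : Submodule ℂ S :=
  weightedHomogeneousSubmodule ℂ (wt a b) n

/-- exponents of weight n -/
def F (a b : ℕ) (n : ℤ) : Finset (ℕ × ℕ) :=
  (Finset.range (n.toNat + 1) ×ˢ Finset.range (n.toNat + 1)).filter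
    (fun p => (p.1 : ℤ) * a + (p.2 : ℤ) * b = n)

lemma mem_F {a b : ℕ} (ha : 1 ≤ a) (hb : 1 ≤ b) {n : ℤ} {p : ℕ × ℕ} :
    p ∈ F a b n ↔ (p.1 : ℤ) * a + (p.2 : ℤ) * b = n := by
  unfold F
  rw [Finset.mem_filter]
  refine ⟨fun h => h.2, fun h => ⟨?_, h⟩⟩
  have h1 : p.1 ≤ p.1 * a := Nat.le_mul_of_pos_right _ ha
  have h2 : p.2 ≤ p.2 * b := Nat.le_mul_of_pos_right _ hb
  have h3 : ((p.1 * a + p.2 * b : ℕ) : ℤ) = n := by push_cast; exact h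
  simp only [Finset.mem_product, Finset.mem_range]
  omega

/-- the Hilbert function -/
def h (a b : ℕ) (n : ℤ) : ℤ := ((F a b n).card : ℤ)

lemma h_rec {a b : ℕ} (ha : 1 ≤ a) (hb : 1 ≤ b) (n : ℤ) :
    h a b n - h a b (n - a) - h a b (n - b) + h a b (n - a - b) = if n = 0 then 1 else 0 := by
  -- first difference
  have key : ∀ k : ℤ, h a b k - h a b (k - a) =
      (((F a b k).filter (fun p => p.1 = 0)).card : ℤ) := by
    intro k
    have h1 := Finset.card_filter_add_card_filter_not (s := F a b k) (fun p => p.1 = 0)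
    have h2 : ((F a b k).filter (fun p => ¬ p.1 = 0)).card = (F a b (k - a)).card := by
      refine Finset.card_nbij' (fun p => (p.1 - 1, p.2)) (fun p => (p.1 + 1, p.2)) ?_ ?_ ?_ ?_
      · rintro ⟨x, y⟩ hp
        simp only [Finset.coe_filter, Set.mem_ofPred_eq, mem_F ha hb, Finset.mem_coe] at hp ⊢
        obtain ⟨z, rfl⟩ := Nat.exists_eq_succ_of_ne_zero hp.2
        have := hp.1
        push_cast at this ⊢
        linarith
      · rintro ⟨x, y⟩ hp
        simp only [Finset.coe_filter, Set.mem_ofPred_eq, mem_F ha hb, Finset.mem_coe] at hp ⊢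
        push_cast
        refine ⟨by linarith, by simp⟩
      · rintro ⟨x, y⟩ hp
        simp only [Finset.coe_filter, Set.mem_ofPred_eq] at hp
        simp only [Prod.mk.injEq, and_true]
        omega
      · rintro ⟨x, y⟩ hp
        simp
    unfold h
    omega
  have key2 : (((F a b n).filter (fun p => p.1 = 0)).card : ℤ) -
      (((F a b (n - b)).filter (fun p => p.1 = 0)).card : ℤ) = if n = 0 then 1 else 0 := by
    have h1 := Finset.card_filter_add_card_filter_not
      (s := (F a b n).filter (fun p => p.1 = 0)) (fun p => p.2 = 0)
    have h2 : (((F a b n).filter (fun p => p.1 = 0)).filter (fun p => ¬ p.2 = 0)).card =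
        ((F a b (n - b)).filter (fun p => p.1 = 0)).card := by
      refine Finset.card_nbij' (fun p => (p.1, p.2 - 1)) (fun p => (p.1, p.2 + 1)) ?_ ?_ ?_ ?_
      · rintro ⟨x, y⟩ hp
        simp only [Finset.coe_filter, Set.mem_ofPred_eq, Finset.mem_filter, mem_F ha hb] at hp ⊢
        obtain ⟨z, rfl⟩ := Nat.exists_eq_succ_of_ne_zero hp.2
        have := hp.1.1
        refine ⟨?_, hp.1.2⟩
        push_cast at this ⊢
        linarith
      · rintro ⟨x, y⟩ hp
        simp only [Finset.coe_filter, Set.mem_ofPred_eq, Finset.mem_filter, mem_F ha hb] at hp ⊢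
        push_cast
        refine ⟨⟨by linarith, hp.2⟩, by simp⟩
      · rintro ⟨x, y⟩ hp
        simp only [Finset.coe_filter, Set.mem_ofPred_eq] at hp
        simp only [Prod.mk.injEq, true_and]
        omega
      · rintro ⟨x, y⟩ hp
        simp
    have h3 : (((F a b n).filter (fun p => p.1 = 0)).filter (fun p => p.2 = 0)).card =
        if n = 0 then 1 else 0 := by
      split_ifs with hn
      · rw [Finset.card_eq_one]
        refine ⟨(0, 0), ?_⟩
        ext ⟨x, y⟩
        simp only [Finset.mem_filter, mem_F ha hb, Finset.mem_singleton, Prod.mk.injEq]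
        constructor
        · rintro ⟨⟨_, h⟩, h'⟩; exact ⟨h, h'⟩
        · rintro ⟨rfl, rfl⟩; simp [hn]
      · rw [Finset.card_eq_zero]
        ext ⟨x, y⟩
        simp only [Finset.mem_filter, mem_F ha hb, Finset.notMem_empty, iff_false]
        rintro ⟨⟨h, h1⟩, h2⟩
        subst h1 h2
        simp at h
        exact hn h.symm
    have h3' : ((((F a b n).filter (fun p => p.1 = 0)).filter (fun p => p.2 = 0)).card : ℤ) =
        if n = 0 then 1 else 0 := by rw [h3]; split_ifs <;> rfl
    omega
  have e1 := key n
  have e2 := key (n - b)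
  rw [show n - (b : ℤ) - a = n - a - b by ring] at e2
  linarith

/-- summation by parts against n² -/
lemma second_moment (p : ℤ → ℤ) (a b e₁ e₂ m₁ m₂ m₃ : ℤ) (hp : p.support.Finite)
    (hrec : ∀ n, p n - p (n - a) - p (n - b) + p (n - a - b) =
      (if n = 0 then 1 else 0) - (if n - m₁ = 0 then 1 else 0) - (if n - m₂ = 0 then 1 else 0)
       - (if n - m₃ = 0 then 1 else 0) + (if n - e₁ = 0 then 1 else 0)
       + (if n - e₂ = 0 then 1 else 0)) :
    2 * a * b * (∑ᶠ n, p n) = e₁ ^ 2 + e₂ ^ 2 - m₁ ^ 2 - m₂ ^ 2 - m₃ ^ 2 := by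
  -- weighted sums of shifts
  have hsupp : ∀ (c : ℤ → ℤ), Function.HasFiniteSupport (fun n => c n * p n) := fun c =>
    hp.subset (fun n hn => by
      simp only [Function.mem_support] at hn ⊢
      exact right_ne_zero_of_mul hn)
  have hsupp' : ∀ (k : ℤ), Function.HasFiniteSupport (fun n : ℤ => n ^ 2 * p (n - k)) := fun k =>
    (hp.image (fun n => n + k)).subset (fun n hn => by
      simp only [Function.mem_support] at hn
      exact ⟨n - k, right_ne_zero_of_mul hn, by ring⟩)
  have shift : ∀ k : ℤ, ∑ᶠ n : ℤ, n ^ 2 * p (n - k) = ∑ᶠ n : ℤ, (n + k) ^ 2 * p n := by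
    intro k
    rw [← finsum_comp_equiv (Equiv.subRight k) (f := fun n : ℤ => (n + k) ^ 2 * p n)]
    simp
  have delta : ∀ m : ℤ, ∑ᶠ n : ℤ, n ^ 2 * (if n - m = 0 then 1 else 0) = m ^ 2 := by
    intro m
    rw [finsum_eq_single _ m]
    · simp
    · intro x hx
      rw [if_neg (sub_ne_zero.2 hx), mul_zero]
  have dsupp : ∀ m : ℤ, Function.HasFiniteSupport
      (fun n : ℤ => n ^ 2 * (if n - m = 0 then (1 : ℤ) else 0)) := fun m =>
    (Set.finite_singleton m).subset (fun n hn => by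
      by_contra hne
      simp only [Set.mem_singleton_iff] at hne
      simp only [Function.mem_support, if_neg (sub_ne_zero.2 hne), mul_zero, ne_eq,
        not_true_eq_false] at hn)
  have L : ∑ᶠ n : ℤ, n ^ 2 * (p n - p (n - a) - p (n - b) + p (n - a - b)) =
      2 * a * b * (∑ᶠ n, p n) := by
    have h0 : ∑ᶠ n : ℤ, n ^ 2 * (p n - p (n - a) - p (n - b) + p (n - a - b)) =
        ∑ᶠ n : ℤ, (n ^ 2 * p (n - 0) - n ^ 2 * p (n - a) - n ^ 2 * p (n - b)
          + n ^ 2 * p (n - (a + b))) := by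
      apply finsum_congr
      intro n
      rw [sub_zero, show n - (a + b) = n - a - b by ring]
      ring
    have h1 : 2 * a * b * (∑ᶠ n, p n) =
        ∑ᶠ n : ℤ, ((n + 0) ^ 2 * p n - (n + a) ^ 2 * p n - (n + b) ^ 2 * p n
          + (n + (a + b)) ^ 2 * p n) := by
      rw [mul_finsum]
      apply finsum_congr
      intro n
      ring
    rw [h0, h1, finsum_add_distrib, finsum_sub_distrib, finsum_sub_distrib,
      finsum_add_distrib, finsum_sub_distrib, finsum_sub_distrib, shift, shift, shift, shift]
    all_goals first
      | exact hsupp _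
      | exact hsupp' _
      | exact (hsupp _).sub (hsupp _)
      | exact (hsupp' _).sub (hsupp' _)
      | exact ((hsupp _).sub (hsupp _)).sub (hsupp _)
      | exact ((hsupp' _).sub (hsupp' _)).sub (hsupp' _)
  rw [← L]
  simp_rw [hrec, mul_add, mul_sub]
  have z : ∀ n : ℤ, (n ^ 2 * (if n = 0 then 1 else 0) : ℤ) = 0 := by
    intro n; split_ifs with h <;> simp [h]
  simp_rw [z, zero_sub]
  rw [finsum_add_distrib, finsum_add_distrib, finsum_sub_distrib, finsum_sub_distrib,
    finsum_neg_distrib]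
  · simp only [delta]; ring
  all_goals first
    | exact dsupp _
    | exact (dsupp _).neg
    | exact (dsupp _).neg.sub (dsupp _)
    | exact ((dsupp _).neg.sub (dsupp _)).sub (dsupp _)
    | exact (((dsupp _).neg.sub (dsupp _)).sub (dsupp _)).add (dsupp _)
end CrossCap

namespace CrossCap
open MvPolynomial

/-- power series from coefficients -/
def mkR (c : (Fin 2 →₀ ℕ) → ℂ) : R := c

lemma coeff_mkR (c : (Fin 2 →₀ ℕ) → ℂ) (d : Fin 2 →₀ ℕ) :
    MvPowerSeries.coeff d (mkR c) = c d := rfl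

/-- exponent vector -/
noncomputable def mon (p : ℕ × ℕ) : Fin 2 →₀ ℕ := Finsupp.single 0 p.1 + Finsupp.single 1 p.2

@[simp] lemma mon_zero (p : ℕ × ℕ) : mon p 0 = p.1 := by simp [mon]
@[simp] lemma mon_one (p : ℕ × ℕ) : mon p 1 = p.2 := by simp [mon]
lemma mon_eta (d : Fin 2 →₀ ℕ) : mon (d 0, d 1) = d := by
  ext i; fin_cases i <;> simp
lemma mon_inj {p q : ℕ × ℕ} (hpq : mon p = mon q) : p = q := by
  ext
  · simpa using DFunLike.congr_fun hpq 0
  · simpa using DFunLike.congr_fun hpq 1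

lemma weight_eq (a b : ℕ) (d : Fin 2 →₀ ℕ) :
    Finsupp.weight (wt a b) d = (d 0 : ℤ) * a + (d 1 : ℤ) * b := by
  rw [Finsupp.weight_apply, Finsupp.sum_fintype _ _ (by simp)]
  simp [wt, Fin.sum_univ_two]

lemma mem_V {a b : ℕ} {n : ℤ} {p : S} :
    p ∈ V a b n ↔ ∀ d, coeff d p ≠ 0 → (d 0 : ℤ) * a + (d 1 : ℤ) * b = n := by
  unfold V
  rw [mem_weightedHomogeneousSubmodule]
  unfold IsWeightedHomogeneous
  simp only [weight_eq, ne_eq]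

lemma mul_mem_V {a b : ℕ} {k m n : ℤ} (hn : k + m = n) {p q : S} (hp : p ∈ V a b k)
    (hq : q ∈ V a b m) : p * q ∈ V a b n := by
  subst hn
  exact IsWeightedHomogeneous.mul hp hq

/-- weighted component of a power series -/
noncomputable def comp (a b : ℕ) (n : ℤ) (f : R) : S :=
  ∑ p ∈ F a b n, monomial (mon p) (MvPowerSeries.coeff (mon p) f)

lemma coeff_comp {a b : ℕ} (ha : 1 ≤ a) (hb : 1 ≤ b) (n : ℤ) (f : R) (d : Fin 2 →₀ ℕ) :
    coeff d (comp a b n f) =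
      if (d 0 : ℤ) * a + (d 1 : ℤ) * b = n then MvPowerSeries.coeff d f else 0 := by
  classical
  unfold comp
  rw [coeff_sum]
  simp only [coeff_monomial]
  split_ifs with hd
  · rw [Finset.sum_eq_single (d 0, d 1)]
    · simp [mon_eta]
    · intro q _ hq
      rw [if_neg]
      rintro rfl
      simp at hq
    · intro hq
      exact absurd ((mem_F ha hb).2 hd) hq
  · apply Finset.sum_eq_zero
    intro q hq
    rw [if_neg]
    rintro rfl
    apply hd
    simpa using (mem_F ha hb).1 hq

lemma comp_mem {a b : ℕ} (ha : 1 ≤ a) (hb : 1 ≤ b) (n : ℤ) (f : R) : comp a b n f ∈ V a b n := by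
  rw [mem_V]
  intro d hd
  rw [coeff_comp ha hb] at hd
  by_contra hne
  exact hd (if_neg hne)

lemma comp_add {a b : ℕ} (ha : 1 ≤ a) (hb : 1 ≤ b) (n : ℤ) (f g : R) :
    comp a b n (f + g) = comp a b n f + comp a b n g := by
  ext d
  simp only [coeff_comp ha hb, coeff_add, map_add]
  split_ifs <;> simp

lemma comp_coe_same {a b : ℕ} (ha : 1 ≤ a) (hb : 1 ≤ b) {n : ℤ} {p : S} (hp : p ∈ V a b n) :
    comp a b n (p : R) = p := by
  ext d
  rw [coeff_comp ha hb, MvPolynomial.coeff_coe]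
  split_ifs with h
  · rfl
  · by_contra hne
    exact h (mem_V.1 hp d (Ne.symm hne))

lemma comp_coe_ne {a b : ℕ} (ha : 1 ≤ a) (hb : 1 ≤ b) {n k : ℤ} (hk : k ≠ n) {p : S}
    (hp : p ∈ V a b k) : comp a b n (p : R) = 0 := by
  ext d
  rw [coeff_comp ha hb, MvPolynomial.coeff_coe, coeff_zero]
  split_ifs with h
  · by_contra hne
    exact hk ((mem_V.1 hp d hne).symm.trans h)
  · rfl

lemma comp_mul {a b : ℕ} (ha : 1 ≤ a) (hb : 1 ≤ b) {k m n : ℤ} (hn : k + m = n) (f : R) {q : S}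
    (hq : q ∈ V a b m) : comp a b n (f * (q : R)) = comp a b k f * q := by
  classical
  ext d
  rw [coeff_comp ha hb, MvPowerSeries.coeff_mul, MvPolynomial.coeff_mul]
  simp only [coeff_comp ha hb, MvPolynomial.coeff_coe]
  have key : ∀ x ∈ Finset.HasAntidiagonal.antidiagonal d, (if (d 0 : ℤ) * a + (d 1 : ℤ) * b = n then
      MvPowerSeries.coeff x.1 f * coeff x.2 q else 0) =
      (if (x.1 0 : ℤ) * a + (x.1 1 : ℤ) * b = k then MvPowerSeries.coeff x.1 f else 0)
        * coeff x.2 q := by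
    intro x hx
    rw [Finset.HasAntidiagonal.mem_antidiagonal] at hx
    by_cases h0 : coeff x.2 q = 0
    · simp [h0]
    have h1 := mem_V.1 hq _ h0
    have h2 : (d 0 : ℤ) = x.1 0 + x.2 0 := by rw [← hx]; simp
    have h3 : (d 1 : ℤ) = x.1 1 + x.2 1 := by rw [← hx]; simp
    have : ((d 0 : ℤ) * a + (d 1 : ℤ) * b = n) ↔ ((x.1 0 : ℤ) * a + (x.1 1 : ℤ) * b = k) := by
      rw [h2, h3, ← hn, ← h1]
      constructor <;> intro h <;> linarith
    simp only [this, ite_mul, zero_mul]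
  rw [← Finset.sum_congr rfl key]
  split_ifs <;> simp

/-- coordinates on a graded piece -/
noncomputable def coordEquiv {a b : ℕ} (ha : 1 ≤ a) (hb : 1 ≤ b) (n : ℤ) :
    V a b n ≃ₗ[ℂ] (F a b n → ℂ) :=
  LinearEquiv.ofBijective
    ({ toFun := fun p q => coeff (mon q.1) p.1
       map_add' := fun p q => by ext; simp
       map_smul' := fun c p => by ext; simp } : V a b n →ₗ[ℂ] (F a b n → ℂ)) (by
    constructor
    · intro p q hpq
      ext d
      by_cases hd : (d 0 : ℤ) * a + (d 1 : ℤ) * b = n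
      · have := congrFun hpq ⟨(d 0, d 1), (mem_F ha hb).2 hd⟩
        simpa [mon_eta] using this
      · have h1 : coeff d p.1 = 0 := by
          by_contra h; exact hd (mem_V.1 p.2 d h)
        have h2 : coeff d q.1 = 0 := by
          by_contra h; exact hd (mem_V.1 q.2 d h)
        rw [h1, h2]
    · intro c
      refine ⟨⟨comp a b n (mkR (fun d => if h : (d 0, d 1) ∈ F a b n then c ⟨_, h⟩ else 0)),
        comp_mem ha hb n _⟩, ?_⟩
      ext ⟨q, hq⟩
      have := (mem_F ha hb).1 hq
      simp only [LinearMap.coe_mk, AddHom.coe_mk, coeff_comp ha hb, mon_zero, mon_one, this, if_true]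
      simp [coeff_mkR, hq])

lemma finite_V {a b : ℕ} (ha : 1 ≤ a) (hb : 1 ≤ b) (n : ℤ) : FiniteDimensional ℂ (V a b n) :=
  Module.Finite.equiv (coordEquiv ha hb n).symm

lemma finrank_V {a b : ℕ} (ha : 1 ≤ a) (hb : 1 ≤ b) (n : ℤ) :
    (Module.finrank ℂ (V a b n) : ℤ) = h a b n := by
  rw [(coordEquiv ha hb n).finrank_eq, Module.finrank_fintype_fun_eq_card, h, Fintype.card_coe]

lemma h_neg {a b : ℕ} (ha : 1 ≤ a) (hb : 1 ≤ b) {n : ℤ} (hn : n < 0) : h a b n = 0 := by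
  unfold h
  rw [Nat.cast_eq_zero, Finset.card_eq_zero]
  ext q
  simp only [mem_F ha hb, Finset.notMem_empty, iff_false]
  intro hq
  have : (0 : ℤ) ≤ (q.1 : ℤ) * a + (q.2 : ℤ) * b := by positivity
  omega

/-- multiplication between graded pieces -/
noncomputable def mulV {a b : ℕ} (k n : ℤ) (q : S) (hq : ∀ p ∈ V a b k, p * q ∈ V a b n) :
    V a b k →ₗ[ℂ] V a b n :=
  ((LinearMap.mulRight ℂ q).comp (V a b k).subtype).codRestrict (V a b n)
    (fun p => hq p.1 p.2)

@[simp] lemma mulV_coe {a b : ℕ} (k n : ℤ) (q : S) (hq : ∀ p ∈ V a b k, p * q ∈ V a b n)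
    (p : V a b k) : ((mulV k n q hq p : V a b n) : S) = p.1 * q := rfl

lemma rank_exact {A B C : Type*} [AddCommGroup A] [AddCommGroup B] [AddCommGroup C]
    [Module ℂ A] [Module ℂ B] [Module ℂ C] [FiniteDimensional ℂ A] [FiniteDimensional ℂ B]
    (f : A →ₗ[ℂ] B) (g : B →ₗ[ℂ] C) (hf : Function.Injective f)
    (hfg : LinearMap.range f = LinearMap.ker g) :
    Module.finrank ℂ (LinearMap.range g) + Module.finrank ℂ A = Module.finrank ℂ B := by
  rw [← LinearMap.finrank_range_add_finrank_ker g, ← hfg, LinearMap.finrank_range_of_inj hf]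

/-- some power of a variable lies in an ideal of finite codimension -/
lemma exists_pow_mem (J : Ideal R) (hfin : FiniteDimensional ℂ (R ⧸ J)) (i : Fin 2) :
    ∃ N : ℕ, (MvPowerSeries.X i : R) ^ N ∈ J := by
  obtain ⟨q, hq, hq0⟩ := Algebra.IsIntegral.isIntegral (R := ℂ)
    (Ideal.Quotient.mkₐ ℂ J (MvPowerSeries.X i))
  obtain ⟨r, hr, hr'⟩ := Polynomial.exists_eq_pow_rootMultiplicity_mul_and_not_dvd q hq.ne_zero 0
  refine ⟨Polynomial.rootMultiplicity 0 q, ?_⟩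
  rw [← Polynomial.aeval_def, Polynomial.aeval_algHom_apply] at hq0
  have hq1 : Polynomial.aeval (MvPowerSeries.X i : R) q ∈ J := by
    rw [← Ideal.Quotient.eq_zero_iff_mem]; exact hq0
  rw [hr, map_mul, map_pow] at hq1
  simp only [map_zero, sub_zero, Polynomial.aeval_X] at hq1
  have hu : IsUnit (Polynomial.aeval (MvPowerSeries.X i : R) r) := by
    rw [MvPowerSeries.isUnit_iff_constantCoeff]
    have : MvPowerSeries.constantCoeff (Polynomial.aeval (MvPowerSeries.X i : R) r) =
        Polynomial.eval 0 r := by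
      rw [Polynomial.aeval_def, Polynomial.hom_eval₂, MvPowerSeries.constantCoeff_X,
        Polynomial.eval₂_at_zero, ← Polynomial.coeff_zero_eq_eval_zero]
      simp [MvPowerSeries.algebraMap_apply]
    rw [this, isUnit_iff_ne_zero]
    intro h0
    exact hr' (Polynomial.dvd_iff_isRoot.2 h0)
  exact (Ideal.mul_unit_mem_iff_mem J hu).1 hq1

/-- power series without small exponents lie in J -/
lemma mem_of_large (J : Ideal R) (N : ℕ) (hN : ∀ i, (MvPowerSeries.X i : R) ^ N ∈ J) (f : R)
    (hf : ∀ d : Fin 2 →₀ ℕ, d 0 < N → d 1 < N → MvPowerSeries.coeff d f = 0) : f ∈ J := by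
  have e : f = mkR (fun d => if d 0 < N then MvPowerSeries.coeff d f else 0) +
      mkR (fun d => if d 0 < N then 0 else MvPowerSeries.coeff d f) := by
    ext d
    rw [map_add]
    simp only [coeff_mkR]
    split_ifs <;> simp
  rw [e]
  refine J.add_mem (J.mem_of_dvd ?_ (hN 1)) (J.mem_of_dvd ?_ (hN 0))
  · rw [MvPowerSeries.X_pow_dvd_iff]
    intro d hd
    simp only [coeff_mkR]
    split_ifs with h
    · exact hf d h hd
    · rfl
  · rw [MvPowerSeries.X_pow_dvd_iff]
    intro d hd
    simp only [coeff_mkR]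
    rw [if_pos hd]

end CrossCap

namespace CrossCap
open MvPolynomial

lemma exists_of_mem {a b : ℕ} (ha : 1 ≤ a) (hb : 1 ≤ b) {m₁ m₂ m₃ n : ℤ} {M₁ M₂ M₃ : S}
    (h₁ : M₁ ∈ V a b m₁) (h₂ : M₂ ∈ V a b m₂) (h₃ : M₃ ∈ V a b m₃) {f : R}
    (hp : f ∈ Ideal.span {(M₃ : R), (M₂ : R), (M₁ : R)}) :
    ∃ x₁ ∈ V a b (n - m₁), ∃ x₂ ∈ V a b (n - m₂), ∃ x₃ ∈ V a b (n - m₃),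
      x₁ * M₁ + (x₂ * M₂ + x₃ * M₃) = comp a b n f := by
  obtain ⟨c₃, c₂, c₁, hc⟩ := Submodule.mem_span_triple.1 hp
  simp only [smul_eq_mul] at hc
  refine ⟨comp a b _ c₁, comp_mem ha hb _ _, comp a b _ c₂, comp_mem ha hb _ _,
    comp a b _ c₃, comp_mem ha hb _ _, ?_⟩
  rw [← hc, comp_add ha hb, comp_add ha hb,
    comp_mul ha hb (show n - m₁ + m₁ = n by ring) c₁ h₁,
    comp_mul ha hb (show n - m₂ + m₂ = n by ring) c₂ h₂,
    comp_mul ha hb (show n - m₃ + m₃ = n by ring) c₃ h₃]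
  ring

lemma inj_core {u₁ u₂ u₃ v₁ v₂ v₃ c₁ c₂ c₃ z : S} (hz : z ≠ 0)
    (hc : c₁ * (u₂ * v₃ - v₂ * u₃) + (c₂ * (u₁ * v₃ - v₁ * u₃) + c₃ * (u₁ * v₂ - v₁ * u₂)) = z)
    {α β : S} (e₁ : α * u₁ + β * v₁ = 0) (e₂ : α * u₂ + β * v₂ = 0) (e₃ : α * u₃ + β * v₃ = 0) :
    α = 0 ∧ β = 0 := by
  have hα : α * z = 0 := by
    rw [← hc]
    linear_combination (c₂ * v₃ + c₃ * v₂) * e₁ + (c₁ * v₃ - c₃ * v₁) * e₂ +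
      (-c₁ * v₂ - c₂ * v₁) * e₃
  have hβ : β * z = 0 := by
    rw [← hc]
    linear_combination (-c₂ * u₃ - c₃ * u₂) * e₁ + (-c₁ * u₃ + c₃ * u₁) * e₂ +
      (c₁ * u₂ + c₂ * u₁) * e₃
  exact ⟨(mul_eq_zero.1 hα).resolve_right hz, (mul_eq_zero.1 hβ).resolve_right hz⟩

lemma cramer_core {u₁ u₂ u₃ v₁ v₂ v₃ c₁ c₂ c₃ z : S}
    (hc : c₁ * (u₂ * v₃ - v₂ * u₃) + (c₂ * (u₁ * v₃ - v₁ * u₃) + c₃ * (u₁ * v₂ - v₁ * u₂)) = z)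
    {x₁ x₂ x₃ : S}
    (hx : x₁ * (u₂ * v₃ - v₂ * u₃) + (x₂ * (u₁ * v₃ - v₁ * u₃) + x₃ * (u₁ * v₂ - v₁ * u₂)) = 0) :
    ∃ α β : S, α * u₁ + β * v₁ = z * x₁ ∧ α * u₂ + β * v₂ = - (z * x₂) ∧
      α * u₃ + β * v₃ = z * x₃ := by
  refine ⟨c₃ * (x₁ * v₂ + x₂ * v₁) + c₂ * (x₁ * v₃ - x₃ * v₁) + c₁ * (-x₂ * v₃ - x₃ * v₂),
    c₃ * (-u₁ * x₂ - u₂ * x₁) + c₂ * (u₁ * x₃ - u₃ * x₁) + c₁ * (u₂ * x₃ + u₃ * x₂), ?_, ?_, ?_⟩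
  · rw [← hc]; linear_combination (-c₁) * hx
  · rw [← hc]; linear_combination c₂ * hx
  · rw [← hc]; linear_combination (-c₃) * hx

lemma pow_dvd_core {N : ℕ} {α α' : S} (e : (X 1 : S) ^ N * α = (X 0 : S) ^ N * α') :
    (X 0 : S) ^ N ∣ α := by
  have hp : Prime (X 0 : S) := X_prime
  refine hp.pow_dvd_of_dvd_mul_left N (a := (X 1 : S) ^ N) ?_ ⟨α', e⟩
  intro hd
  have := X_dvd_X.1 (hp.dvd_of_dvd_pow hd)
  exact absurd this (by decide)

lemma exact_core {u₁ u₂ u₃ v₁ v₂ v₃ : S} {N : ℕ} {c₁ c₂ c₃ c₁' c₂' c₃' : S}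
    (hc : c₁ * (u₂ * v₃ - v₂ * u₃) + (c₂ * (u₁ * v₃ - v₁ * u₃) + c₃ * (u₁ * v₂ - v₁ * u₂)) =
      X 0 ^ N)
    (hc' : c₁' * (u₂ * v₃ - v₂ * u₃) + (c₂' * (u₁ * v₃ - v₁ * u₃) + c₃' * (u₁ * v₂ - v₁ * u₂)) =
      X 1 ^ N)
    {x₁ x₂ x₃ : S}
    (hx : x₁ * (u₂ * v₃ - v₂ * u₃) + (x₂ * (u₁ * v₃ - v₁ * u₃) + x₃ * (u₁ * v₂ - v₁ * u₂)) = 0) :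
    ∃ α β : S, α * u₁ + β * v₁ = x₁ ∧ α * u₂ + β * v₂ = - x₂ ∧ α * u₃ + β * v₃ = x₃ := by
  obtain ⟨α, β, e₁, e₂, e₃⟩ := cramer_core hc hx
  obtain ⟨α', β', e₁', e₂', e₃'⟩ := cramer_core hc' hx
  have hX : (X 0 : S) ^ N ≠ 0 := pow_ne_zero _ (X_ne_zero 0)
  obtain ⟨h1, h2⟩ := inj_core (α := X 1 ^ N * α - X 0 ^ N * α') (β := X 1 ^ N * β - X 0 ^ N * β')
    hX hc (by linear_combination X 1 ^ N * e₁ - X 0 ^ N * e₁')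
    (by linear_combination X 1 ^ N * e₂ - X 0 ^ N * e₂')
    (by linear_combination X 1 ^ N * e₃ - X 0 ^ N * e₃')
  obtain ⟨α₀, rfl⟩ := pow_dvd_core (sub_eq_zero.1 h1)
  obtain ⟨β₀, rfl⟩ := pow_dvd_core (sub_eq_zero.1 h2)
  refine ⟨α₀, β₀, ?_, ?_, ?_⟩
  · apply mul_left_cancel₀ hX; linear_combination e₁
  · apply mul_left_cancel₀ hX; linear_combination e₂
  · apply mul_left_cancel₀ hX; linear_combination e₃

/-- the graded piece of the minor map -/
noncomputable def Mn {a b : ℕ} (m₁ m₂ m₃ : ℤ) {M₁ M₂ M₃ : S}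
    (h₁ : M₁ ∈ V a b m₁) (h₂ : M₂ ∈ V a b m₂) (h₃ : M₃ ∈ V a b m₃) (n : ℤ) :
    (V a b (n - m₁) × V a b (n - m₂) × V a b (n - m₃)) →ₗ[ℂ] V a b n :=
  (mulV (n - m₁) n M₁ (fun _ hp => mul_mem_V (by ring) hp h₁)).coprod
    ((mulV (n - m₂) n M₂ (fun _ hp => mul_mem_V (by ring) hp h₂)).coprod
      (mulV (n - m₃) n M₃ (fun _ hp => mul_mem_V (by ring) hp h₃)))

lemma Mn_coe {a b : ℕ} {m₁ m₂ m₃ : ℤ} {M₁ M₂ M₃ : S}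
    (h₁ : M₁ ∈ V a b m₁) (h₂ : M₂ ∈ V a b m₂) (h₃ : M₃ ∈ V a b m₃) (n : ℤ)
    (x : V a b (n - m₁) × V a b (n - m₂) × V a b (n - m₃)) :
    ((Mn m₁ m₂ m₃ h₁ h₂ h₃ n x : V a b n) : S) =
      x.1.1 * M₁ + (x.2.1.1 * M₂ + x.2.2.1 * M₃) := by
  simp [Mn]

lemma finrank_aux {K : ℕ} {E : Fin K → Type} [∀ i, AddCommGroup (E i)] [∀ i, Module ℂ (E i)]
    [∀ i, FiniteDimensional ℂ (E i)] (W : ∀ i, Submodule ℂ (E i)) {Q : Type*} [AddCommGroup Q]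
    [Module ℂ Q] (Ψ : (∀ i, E i) →ₗ[ℂ] Q) (hs : LinearMap.range Ψ = ⊤)
    (hk : ∀ x, Ψ x = 0 ↔ ∀ i, x i ∈ W i) :
    (Module.finrank ℂ Q : ℤ) =
      ∑ i, ((Module.finrank ℂ (E i) : ℤ) - Module.finrank ℂ (W i)) := by
  let θ : (∀ i, E i) →ₗ[ℂ] (∀ i, E i ⧸ W i) :=
    LinearMap.pi (fun i => (W i).mkQ ∘ₗ LinearMap.proj i)
  have hsurjθ : LinearMap.range θ = ⊤ := by
    rw [LinearMap.range_eq_top]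
    intro y
    choose x hx using fun i => Submodule.mkQ_surjective _ (y i)
    exact ⟨x, funext hx⟩
  have hker : LinearMap.ker Ψ = LinearMap.ker θ := by
    ext x
    rw [LinearMap.mem_ker, LinearMap.mem_ker, hk, funext_iff]
    simp [θ]
  have r1 := LinearMap.finrank_range_add_finrank_ker Ψ
  have r2 := LinearMap.finrank_range_add_finrank_ker θ
  rw [hs, finrank_top] at r1
  rw [hsurjθ, finrank_top, Module.finrank_pi_fintype] at r2
  rw [hker] at r1
  have r3 : Module.finrank ℂ Q = ∑ i, Module.finrank ℂ (E i ⧸ W i) := by omega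
  rw [r3, Nat.cast_sum]
  apply Finset.sum_congr rfl
  intro i _
  have := Submodule.finrank_quotient_add_finrank (W i)
  omega

/-- the dimension of the quotient is the sum over the graded pieces -/
lemma finrank_quot {a b : ℕ} (ha : 1 ≤ a) (hb : 1 ≤ b) {m₁ m₂ m₃ : ℤ} {M₁ M₂ M₃ : S}
    (h₁ : M₁ ∈ V a b m₁) (h₂ : M₂ ∈ V a b m₂) (h₃ : M₃ ∈ V a b m₃)
    (J : Ideal R) (hJ : J = Ideal.span {(M₃ : R), (M₂ : R), (M₁ : R)}) (K : ℕ)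
    (hK : ∀ f : R, (∀ n : ℕ, n < K → comp a b n f = 0) → f ∈ J) :
    (Module.finrank ℂ (R ⧸ J) : ℤ) = ∑ i : Fin K,
      ((Module.finrank ℂ (V a b (i : ℕ)) : ℤ) -
        Module.finrank ℂ (LinearMap.range (Mn m₁ m₂ m₃ h₁ h₂ h₃ (i : ℕ)))) := by
  have := finite_V ha hb
  -- the two maps
  let Ψ : (∀ i : Fin K, V a b ((i : ℕ) : ℤ)) →ₗ[ℂ] (R ⧸ J) :=
    (Ideal.Quotient.mkₐ ℂ J).toLinearMap ∘ₗ
      (MvPolynomial.coeToMvPowerSeries.algHom ℂ).toLinearMap ∘ₗ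
        (∑ i : Fin K, (V a b ((i : ℕ) : ℤ)).subtype ∘ₗ LinearMap.proj i)
  have hΨ : ∀ x, Ψ x = Ideal.Quotient.mk J (((∑ i, (x i).1 : S)) : R) := by
    intro x
    simp only [Ψ, LinearMap.comp_apply, LinearMap.sum_apply, LinearMap.proj_apply,
      Submodule.subtype_apply, AlgHom.toLinearMap_apply, Ideal.Quotient.mkₐ_eq_mk]
    congr 1
  have hcomp : ∀ (x : ∀ i : Fin K, V a b ((i : ℕ) : ℤ)) (j : Fin K),
      comp a b ((j : ℕ) : ℤ) (((∑ i, (x i).1 : S)) : R) = (x j).1 := by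
    intro x j
    have hs : ∀ s : Finset (Fin K), comp a b ((j : ℕ) : ℤ) (((∑ i ∈ s, (x i).1 : S)) : R) =
        ∑ i ∈ s, comp a b ((j : ℕ) : ℤ) ((x i).1 : R) := by
      classical
      intro s
      induction s using Finset.induction_on with
      | empty => simp [comp]
      | insert i s hi ih =>
        rw [Finset.sum_insert hi, Finset.sum_insert hi, MvPolynomial.coe_add, comp_add ha hb, ih]
    rw [hs, Finset.sum_eq_single j]
    · exact comp_coe_same ha hb (x j).2
    · intro i _ hij
      refine comp_coe_ne ha hb ?_ (x i).2
      intro h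
      apply hij
      ext
      exact_mod_cast h
    · simp
  have hsurjΨ : LinearMap.range Ψ = ⊤ := by
    rw [LinearMap.range_eq_top]
    intro y
    obtain ⟨f, rfl⟩ := Ideal.Quotient.mk_surjective y
    refine ⟨fun i => ⟨comp a b ((i : ℕ) : ℤ) f, comp_mem ha hb _ _⟩, ?_⟩
    rw [hΨ, Ideal.Quotient.eq]
    apply hK
    intro n hn
    have h1 := hcomp (fun i => ⟨comp a b ((i : ℕ) : ℤ) f, comp_mem ha hb _ _⟩) ⟨n, hn⟩
    have h2 := comp_add ha hb n ((((∑ i : Fin K, comp a b ((i : ℕ) : ℤ) f : S)) : R) - f) f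
    rw [sub_add_cancel] at h2
    simp only at h1
    rw [h1] at h2
    exact left_eq_add.1 (by rw [add_comm]; exact h2)
  refine finrank_aux (fun i : Fin K => LinearMap.range (Mn m₁ m₂ m₃ h₁ h₂ h₃ ((i : ℕ) : ℤ)))
    Ψ hsurjΨ (fun x => ?_)
  rw [hΨ, Ideal.Quotient.eq_zero_iff_mem]
  constructor
  · intro hx j
    rw [hJ] at hx
    obtain ⟨x₁, hx₁, x₂, hx₂, x₃, hx₃, e⟩ := exists_of_mem ha hb h₁ h₂ h₃ (n := ((j : ℕ) : ℤ)) hx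
    refine ⟨(⟨x₁, hx₁⟩, ⟨x₂, hx₂⟩, ⟨x₃, hx₃⟩), ?_⟩
    apply Subtype.ext
    rw [Mn_coe, e, hcomp]
  · intro hx
    have hm : ∀ i, (((x i).1 : S) : R) ∈ J := by
      intro i
      obtain ⟨z, hz⟩ := hx i
      rw [← hz, Mn_coe, hJ]
      rw [show Ideal.span {(M₃ : R), (M₂ : R), (M₁ : R)} =
        Submodule.span R {(M₃ : R), (M₂ : R), (M₁ : R)} from rfl, Submodule.mem_span_triple]
      refine ⟨z.2.2.1, z.2.1.1, z.1.1, ?_⟩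
      simp only [smul_eq_mul, MvPolynomial.coe_add, MvPolynomial.coe_mul]
      ring
    have : (((∑ i, (x i).1 : S)) : R) = ∑ i, (((x i).1 : S) : R) :=
      map_sum (MvPolynomial.coeToMvPowerSeries.ringHom (R := ℂ) (σ := Fin 2)) _ _
    rw [this]
    exact J.sum_mem (fun i _ => hm i)

end CrossCap

namespace CrossCap
open MvPolynomial

lemma core {a b : ℕ} (ha : 1 ≤ a) (hb : 1 ≤ b) {d₁ d₂ d₃ : ℤ} {u₁ u₂ u₃ v₁ v₂ v₃ : S}
    (hu₁ : u₁ ∈ V a b (d₁ - a)) (hu₂ : u₂ ∈ V a b (d₂ - a)) (hu₃ : u₃ ∈ V a b (d₃ - a))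
    (hv₁ : v₁ ∈ V a b (d₁ - b)) (hv₂ : v₂ ∈ V a b (d₂ - b)) (hv₃ : v₃ ∈ V a b (d₃ - b))
    (J : Ideal R) (hJ : J = Ideal.span {((u₁ * v₂ - v₁ * u₂ : S) : R),
      ((u₁ * v₃ - v₁ * u₃ : S) : R), ((u₂ * v₃ - v₂ * u₃ : S) : R)})
    (hfin : FiniteDimensional ℂ (R ⧸ J)) :
    (a : ℤ) * b * Module.finrank ℂ (R ⧸ J) =
      d₁ * d₂ + d₂ * d₃ + d₃ * d₁ - ((a : ℤ) + b) * (d₁ + d₂ + d₃ - a - b) - (a : ℤ) * b := by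
  have hM₁ : u₂ * v₃ - v₂ * u₃ ∈ V a b (d₂ + d₃ - a - b) :=
    Submodule.sub_mem _ (mul_mem_V (by ring) hu₂ hv₃) (mul_mem_V (by ring) hv₂ hu₃)
  have hM₂ : u₁ * v₃ - v₁ * u₃ ∈ V a b (d₁ + d₃ - a - b) :=
    Submodule.sub_mem _ (mul_mem_V (by ring) hu₁ hv₃) (mul_mem_V (by ring) hv₁ hu₃)
  have hM₃ : u₁ * v₂ - v₁ * u₂ ∈ V a b (d₁ + d₂ - a - b) :=
    Submodule.sub_mem _ (mul_mem_V (by ring) hu₁ hv₂) (mul_mem_V (by ring) hv₁ hu₂)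
  have hfV := finite_V ha hb
  -- powers of the variables
  obtain ⟨N, hN⟩ : ∃ N : ℕ, ∀ i, (MvPowerSeries.X i : R) ^ N ∈ J := by
    choose N hN using exists_pow_mem J hfin
    exact ⟨N 0 + N 1, fun i => by
      fin_cases i
      · exact J.mem_of_dvd (pow_dvd_pow _ (Nat.le_add_right _ _)) (hN 0)
      · exact J.mem_of_dvd (pow_dvd_pow _ (Nat.le_add_left _ _)) (hN 1)⟩
  have hXV : ∀ i, (X i : S) ^ N ∈ V a b (N • wt a b i) := fun i =>
    (isWeightedHomogeneous_X ℂ (wt a b) i).pow N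
  have hXJ : ∀ i, ∃ c₁ c₂ c₃ : S, c₁ * (u₂ * v₃ - v₂ * u₃) + (c₂ * (u₁ * v₃ - v₁ * u₃) +
      c₃ * (u₁ * v₂ - v₁ * u₂)) = X i ^ N := by
    intro i
    have h1 := hN i
    rw [hJ] at h1
    obtain ⟨c₁, -, c₂, -, c₃, -, e⟩ := exists_of_mem ha hb hM₁ hM₂ hM₃ (n := N • wt a b i) h1
    refine ⟨c₁, c₂, c₃, ?_⟩
    rw [e]
    have : (MvPowerSeries.X i : R) ^ N = ((X i ^ N : S) : R) := by
      rw [MvPolynomial.coe_pow, MvPolynomial.coe_X]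
    rw [this, comp_coe_same ha hb (hXV i)]
  obtain ⟨c₁, c₂, c₃, hc⟩ := hXJ 0
  obtain ⟨c₁', c₂', c₃', hc'⟩ := hXJ 1
  have hrank : ∀ n : ℤ, (Module.finrank ℂ (LinearMap.range (Mn _ _ _ hM₁ hM₂ hM₃ n)) : ℤ) =
      h a b (n - (d₂ + d₃ - a - b)) + h a b (n - (d₁ + d₃ - a - b)) +
      h a b (n - (d₁ + d₂ - a - b)) - h a b (n - (d₁ + d₂ + d₃ - 2 * a - b)) -
      h a b (n - (d₁ + d₂ + d₃ - a - 2 * b)) := by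
    intro n
    set e₁ : ℤ := d₁ + d₂ + d₃ - 2 * a - b with he₁
    set e₂ : ℤ := d₁ + d₂ + d₃ - a - 2 * b with he₂
    let φ : (V a b (n - e₁) × V a b (n - e₂)) →ₗ[ℂ] (V a b (n - (d₂ + d₃ - a - b)) ×
        V a b (n - (d₁ + d₃ - a - b)) × V a b (n - (d₁ + d₂ - a - b))) :=
      ((mulV _ _ u₁ (fun _ hp => mul_mem_V (by rw [he₁]; ring) hp hu₁)).coprod
        (mulV _ _ v₁ (fun _ hp => mul_mem_V (by rw [he₂]; ring) hp hv₁))).prod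
      (((mulV _ _ (-u₂) (fun _ hp => mul_mem_V (by rw [he₁]; ring) hp
          (Submodule.neg_mem _ hu₂))).coprod
        (mulV _ _ (-v₂) (fun _ hp => mul_mem_V (by rw [he₂]; ring) hp
          (Submodule.neg_mem _ hv₂)))).prod
      ((mulV _ _ u₃ (fun _ hp => mul_mem_V (by rw [he₁]; ring) hp hu₃)).coprod
        (mulV _ _ v₃ (fun _ hp => mul_mem_V (by rw [he₂]; ring) hp hv₃))))
    have f1 : ∀ x, (φ x).1.1 = x.1.1 * u₁ + x.2.1 * v₁ := fun x => by simp [φ]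
    have f2 : ∀ x, (φ x).2.1.1 = -(x.1.1 * u₂ + x.2.1 * v₂) := fun x => by simp [φ]; ring
    have f3 : ∀ x, (φ x).2.2.1 = x.1.1 * u₃ + x.2.1 * v₃ := fun x => by simp [φ]
    have hinj : Function.Injective φ := by
      rw [← LinearMap.ker_eq_bot, LinearMap.ker_eq_bot']
      intro x hx
      obtain ⟨hα, hβ⟩ := inj_core (α := x.1.1) (β := x.2.1) (pow_ne_zero _ (X_ne_zero 0)) hc
        (by rw [← f1, hx]; rfl) (by rw [← neg_eq_zero, ← f2, hx]; rfl) (by rw [← f3, hx]; rfl)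
      exact Prod.ext (Subtype.ext hα) (Subtype.ext hβ)
    have hex : LinearMap.range φ = LinearMap.ker (Mn _ _ _ hM₁ hM₂ hM₃ n) := by
      apply le_antisymm
      · rintro _ ⟨x, rfl⟩
        rw [LinearMap.mem_ker]
        apply Subtype.ext
        rw [Mn_coe, f1, f2, f3]
        rw [Submodule.coe_zero]
        ring
      · intro x hx
        rw [LinearMap.mem_ker] at hx
        have hx' := congrArg Subtype.val hx
        rw [Mn_coe, Submodule.coe_zero] at hx'
        obtain ⟨α, β, q₁, q₂, q₃⟩ := exact_core hc hc' hx'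
        have g : ∀ (k e₁' e₂' : ℤ) (u v z : S), u ∈ V a b e₁' → v ∈ V a b e₂' → z ∈ V a b k →
            n - e₁ + e₁' = k → n - e₂ + e₂' = k → α * u + β * v = z →
            comp a b (n - e₁) (α : R) * u + comp a b (n - e₂) (β : R) * v = z := by
          intro k e₁' e₂' u v z hu hv hz h1 h2 h3
          rw [← comp_mul ha hb h1 _ hu, ← comp_mul ha hb h2 _ hv, ← comp_add ha hb,
            ← MvPolynomial.coe_mul, ← MvPolynomial.coe_mul, ← MvPolynomial.coe_add, h3,
            comp_coe_same ha hb hz]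
        refine ⟨(⟨comp a b (n - e₁) (α : R), comp_mem ha hb _ _⟩,
          ⟨comp a b (n - e₂) (β : R), comp_mem ha hb _ _⟩), ?_⟩
        refine Prod.ext (Subtype.ext ?_) (Prod.ext (Subtype.ext ?_) (Subtype.ext ?_))
        · rw [f1]
          exact g _ _ _ _ _ _ hu₁ hv₁ x.1.2 (by rw [he₁]; ring) (by rw [he₂]; ring) q₁
        · rw [f2, g _ _ _ _ _ _ hu₂ hv₂ (Submodule.neg_mem _ x.2.1.2)
            (by rw [he₁]; ring) (by rw [he₂]; ring) q₂, neg_neg]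
        · rw [f3]
          exact g _ _ _ _ _ _ hu₃ hv₃ x.2.2.2 (by rw [he₁]; ring) (by rw [he₂]; ring) q₃
    have := rank_exact φ _ hinj hex
    rw [Module.finrank_prod, Module.finrank_prod, Module.finrank_prod] at this
    simp only [← finrank_V ha hb]
    omega
  -- large degrees
  obtain ⟨K, hKdef⟩ : ∃ K : ℕ, K = N * (a + b) + 1 := ⟨_, rfl⟩
  have hK : ∀ f : R, (∀ n : ℕ, n < K → comp a b n f = 0) → f ∈ J := by
    intro f hf
    refine mem_of_large J N hN f (fun d h0 h1 => ?_)
    have hlt : d 0 * a + d 1 * b < K := by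
      have := Nat.mul_le_mul_right a h0.le
      have := Nat.mul_le_mul_right b h1.le
      rw [hKdef, Nat.mul_add]
      omega
    have := congrArg (coeff d) (hf _ hlt)
    rw [coeff_comp ha hb, if_pos (by push_cast; rfl)] at this
    simpa using this
  have hdim := finrank_quot ha hb hM₁ hM₂ hM₃ J hJ K hK
  -- the Hilbert function of the quotient
  let p : ℤ → ℤ := fun n => (Module.finrank ℂ (V a b n) : ℤ) -
    Module.finrank ℂ (LinearMap.range (Mn _ _ _ hM₁ hM₂ hM₃ n))
  have hp0 : ∀ n, n < 0 → p n = 0 := by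
    intro n hn
    have h1 : (Module.finrank ℂ (V a b n) : ℤ) = 0 := by rw [finrank_V ha hb, h_neg ha hb hn]
    have h2 := Submodule.finrank_le (LinearMap.range (Mn _ _ _ hM₁ hM₂ hM₃ n))
    simp only [p]
    omega
  have hp1 : ∀ n, (K : ℤ) ≤ n → p n = 0 := by
    intro n hn
    have : LinearMap.range (Mn _ _ _ hM₁ hM₂ hM₃ n) = ⊤ := by
      rw [LinearMap.range_eq_top]
      intro x
      have hx : (x.1 : R) ∈ J := by
        apply hK
        intro k hk
        exact comp_coe_ne ha hb (by omega) x.2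
      rw [hJ] at hx
      obtain ⟨x₁, hx₁, x₂, hx₂, x₃, hx₃, e⟩ := exists_of_mem ha hb hM₁ hM₂ hM₃ (n := n) hx
      refine ⟨(⟨x₁, hx₁⟩, ⟨x₂, hx₂⟩, ⟨x₃, hx₃⟩), ?_⟩
      apply Subtype.ext
      rw [Mn_coe, e, comp_coe_same ha hb x.2]
    simp only [p]
    rw [this, finrank_top, sub_self]
  have hsub : Function.support p ⊆ ((Finset.Ico (0 : ℤ) K : Finset ℤ) : Set ℤ) := by
    intro n hn
    rw [Finset.coe_Ico, Set.mem_Ico]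
    by_contra hcon
    rw [not_and_or, not_le, not_lt] at hcon
    exact hn (hcon.elim (hp0 n) (hp1 n))
  have hsum : ∑ᶠ n, p n = (Module.finrank ℂ (R ⧸ J) : ℤ) := by
    rw [hdim, finsum_eq_sum_of_support_subset p hsub, Fin.sum_univ_eq_sum_range
      (fun i : ℕ => p (i : ℤ)) K]
    symm
    refine Finset.sum_nbij' (fun i : ℕ => (i : ℤ)) Int.toNat ?_ ?_ ?_ ?_ ?_
    · intro i hi; simp at hi ⊢; exact hi
    · intro i hi; simp at hi ⊢; omega
    · intro i hi; simp
    · intro i hi; simp at hi ⊢; omega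
    · intro i hi; rfl
  have hmom := second_moment p a b (d₁ + d₂ + d₃ - 2 * a - b) (d₁ + d₂ + d₃ - a - 2 * b)
    (d₂ + d₃ - a - b) (d₁ + d₃ - a - b) (d₁ + d₂ - a - b)
    ((Finset.finite_toSet _).subset hsub) (by
      intro n
      have hpn : ∀ n, p n = h a b n - (h a b (n - (d₂ + d₃ - a - b)) +
        h a b (n - (d₁ + d₃ - a - b)) +
        h a b (n - (d₁ + d₂ - a - b)) - h a b (n - (d₁ + d₂ + d₃ - 2 * a - b)) -
        h a b (n - (d₁ + d₂ + d₃ - a - 2 * b))) := by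
        intro n
        simp only [p]
        rw [hrank, finrank_V ha hb]
      simp only [hpn]
      have r0 := h_rec ha hb n
      have r : ∀ m : ℤ, h a b (n - m) - h a b (n - a - m) - h a b (n - b - m) +
          h a b (n - a - b - m) = if n - m = 0 then 1 else 0 := by
        intro m
        have := h_rec ha hb (n - m)
        rw [show n - m - a = n - a - m by ring, show n - m - b = n - b - m by ring,
          show n - a - m - b = n - a - b - m by ring] at this
        exact this
      rw [← r0, ← r, ← r, ← r, ← r, ← r]
      ring)
  rw [hsum] at hmom
  have : 2 * ((a : ℤ) * b * Module.finrank ℂ (R ⧸ J)) = 2 * (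
      d₁ * d₂ + d₂ * d₃ + d₃ * d₁ - ((a : ℤ) + b) * (d₁ + d₂ + d₃ - a - b) - (a : ℤ) * b) := by
    linear_combination hmom
  omega

lemma pderiv_mem {a b d : ℕ} {g : S} (hg : IsWeightedHomogeneous ![a, b] g d) :
    pderiv 0 g ∈ V a b ((d : ℤ) - a) ∧ pderiv 1 g ∈ V a b ((d : ℤ) - b) := by
  have h1 : IsWeightedHomogeneous (wt a b) g (d : ℤ) := by
    intro e he
    have := hg he
    rw [weight_eq]
    rw [Finsupp.weight_apply, Finsupp.sum_fintype _ _ (by simp)] at this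
    simp only [Fin.sum_univ_two, Matrix.cons_val_zero, Matrix.cons_val_one, smul_eq_mul] at this
    exact_mod_cast this
  exact ⟨h1.pderiv (by simp [wt]), h1.pderiv (by simp [wt])⟩

end CrossCap

/-- Mond's formula: if `g₁, g₂, g₃ ∈ ℂ[s,t]` are weighted homogeneous of degrees
`d₁, d₂, d₃` for weights `(w₁, w₂)` and the Jacobian minor ideal `J ⊆ ℂ[[s,t]]` has
finite codimension, then
`w₁w₂ · dim_ℂ(R/J) = d₁d₂ + d₂d₃ + d₃d₁ − (w₁+w₂)(d₁+d₂+d₃−w₁−w₂) − w₁w₂`. -/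
theorem stmt_8 (w₁ w₂ : ℕ) (hw₁ : 1 ≤ w₁) (hw₂ : 1 ≤ w₂)
    (g₁ g₂ g₃ : MvPolynomial (Fin 2) ℂ) (d₁ d₂ d₃ : ℕ)
    (hd₁ : 1 ≤ d₁) (hd₂ : 1 ≤ d₂) (hd₃ : 1 ≤ d₃)
    (hg₁ : MvPolynomial.IsWeightedHomogeneous ![w₁, w₂] g₁ d₁)
    (hg₂ : MvPolynomial.IsWeightedHomogeneous ![w₁, w₂] g₂ d₂)
    (hg₃ : MvPolynomial.IsWeightedHomogeneous ![w₁, w₂] g₃ d₃)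
    (J : Ideal (MvPowerSeries (Fin 2) ℂ))
    (hJ : J = Ideal.span
      {((MvPolynomial.pderiv 0 g₁ * MvPolynomial.pderiv 1 g₂ -
          MvPolynomial.pderiv 1 g₁ * MvPolynomial.pderiv 0 g₂ :
          MvPolynomial (Fin 2) ℂ) : MvPowerSeries (Fin 2) ℂ),
        ((MvPolynomial.pderiv 0 g₁ * MvPolynomial.pderiv 1 g₃ -
          MvPolynomial.pderiv 1 g₁ * MvPolynomial.pderiv 0 g₃ :
          MvPolynomial (Fin 2) ℂ) : MvPowerSeries (Fin 2) ℂ),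
        ((MvPolynomial.pderiv 0 g₂ * MvPolynomial.pderiv 1 g₃ -
          MvPolynomial.pderiv 1 g₂ * MvPolynomial.pderiv 0 g₃ :
          MvPolynomial (Fin 2) ℂ) : MvPowerSeries (Fin 2) ℂ)})
    (hfin : FiniteDimensional ℂ (MvPowerSeries (Fin 2) ℂ ⧸ J)) :
    (w₁ : ℤ) * w₂ * Module.finrank ℂ (MvPowerSeries (Fin 2) ℂ ⧸ J) =
      (d₁ : ℤ) * d₂ + (d₂ : ℤ) * d₃ + (d₃ : ℤ) * d₁ -
        ((w₁ : ℤ) + w₂) * ((d₁ : ℤ) + d₂ + d₃ - w₁ - w₂) - (w₁ : ℤ) * w₂ := by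
  obtain ⟨hu₁, hv₁⟩ := CrossCap.pderiv_mem hg₁
  obtain ⟨hu₂, hv₂⟩ := CrossCap.pderiv_mem hg₂
  obtain ⟨hu₃, hv₃⟩ := CrossCap.pderiv_mem hg₃
  exact CrossCap.core hw₁ hw₂ hu₁ hu₂ hu₃ hv₁ hv₂ hv₃ J hJ hfin
end
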